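/- arXiv:2209.02087 — 2 statements merged into one kernel-verified Lean document; each statement's English description precedes it below -/
import Mathlib

section
/- For every ω ∈ (ℝ∖ℚ)/ℤ and every nonzero β ∈ ℝ, there exists a residual subset U_β ⊂ C⁰(𝕋,ℝ) (with the uniform topology) such that for every q ∈ U_β, the set {(τ,α) ∈ ℝ×(0,1) : f_{α,β,τ,q} is mode-locked} is an open and dense subset of ℝ×(0,1). -/
open Filter Topology MeasureTheory

namespace ForcedCircle

variable {X : Type*}

/-- Forward fiberwise iteration: `(F^n)_x = F_{g^{n-1} x} ∘ ⋯ ∘ F_x`. -/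
def fiberIter (g : X → X) (F : X → ℝ → ℝ) : ℕ → X → ℝ → ℝ
  | 0, _, y => y
  | n + 1, x, y => F (g^[n] x) (fiberIter g F n x y)

/-- Lift data of a `g`-forced circle homeomorphism: a fiberwise increasing
homeomorphism of `ℝ` commuting with `y ↦ y + 1`, jointly continuous. -/
structure ForcedLift [TopologicalSpace X] (g : X → X) where
  F : X → ℝ → ℝ
  cont : Continuous fun p : X × ℝ => F p.1 p.2
  mono : ∀ x, StrictMono (F x)
  surj : ∀ x, Function.Surjective (F x)
  periodic : ∀ x y, F x (y + 1) = F x y + 1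

/-- `Diff^{0,1}_g(X×𝕋)`: fibers are orientation-preserving `C¹` circle
diffeomorphisms depending continuously (in the `C¹` topology) on the base point. -/
structure ForcedC1 [TopologicalSpace X] (g : X → X) extends ForcedLift g where
  fiber_c1 : ∀ x, ContDiff ℝ 1 (F x)
  deriv_pos : ∀ x y, 0 < deriv (F x) y
  deriv_cont : Continuous fun p : X × ℝ => deriv (F p.1) p.2

/-- `ρ` is the fibered rotation number of the lifted forced system `F`. -/
def HasRotNum (g : X → X) (F : X → ℝ → ℝ) (ρ : ℝ) : Prop :=
  ∀ x y, Tendsto (fun n : ℕ => (fiberIter g F n x y - y) / n) atTop (nhds ρ)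

/-- The circle projections of the forced systems lifted by `F` and `F'` are
pointwise within `δ`. -/
def CircleClose (F F' : X → ℝ → ℝ) (δ : ℝ) : Prop :=
  ∀ x y, ∃ m : ℤ, |F' x y - F x y - (m : ℝ)| < δ

/-- Mode-locking: the rotation number (mod `1`) is constant on a `C⁰`
neighbourhood of the forced circle homeomorphism lifted by `F`. -/
def ModeLocked [TopologicalSpace X] (g : X → X) (F : X → ℝ → ℝ) : Prop :=
  ∃ δ : ℝ, 0 < δ ∧ ∀ F' : ForcedLift g, CircleClose F F'.F δ →
    ∀ ρ ρ' : ℝ, HasRotNum g F ρ → HasRotNum g F'.F ρ' → ∃ m : ℤ, ρ' = ρ + (m : ℝ)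

/-- `g` admits exactly one invariant Borel probability measure. -/
def UniquelyErgodic [MeasurableSpace X] (g : X → X) : Prop :=
  ∃! μ : ProbabilityMeasure X, Measure.map g (μ : Measure X) = (μ : Measure X)

def Minimal [TopologicalSpace X] (g : X → X) : Prop :=
  ∀ x, Dense (Set.range fun n : ℕ => g^[n] x)

/-- `g` has a non-periodic factor of finite dimension: an infinite compact
subset of some Euclidean space carrying a homeomorphic factor of `g`. -/
def HasFinDimNonperiodicFactor [TopologicalSpace X] (g : X → X) : Prop :=
  ∃ (d : ℕ) (Y : Set (Fin d → ℝ)) (gbar : Y ≃ₜ Y) (h : X → Y),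
    Y.Infinite ∧ IsCompact Y ∧ Continuous h ∧ Function.Surjective h ∧
      ∀ x, h (g x) = gbar (h x)

/-- The range of the Schwartzman asymptotic cycle of `g` (w.r.t. the invariant
measure `ν`). -/
def SchwartzmanGroup [TopologicalSpace X] [MeasurableSpace X] (g : X → X)
    (ν : Measure X) : Set ℝ :=
  {t | ∃ (φ : X → ℝ) (ψ : X → AddCircle (1 : ℝ)), Continuous φ ∧ Continuous ψ ∧
    t = ∫ x, φ x ∂ν ∧ ∀ x, ψ (g x) - ψ x = ((φ x : ℝ) : AddCircle (1 : ℝ))}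

/-- A lift of an orientation-preserving `C^r` circle diffeomorphism. -/
def IsCrLift (r : ℕ∞) (f : ℝ → ℝ) : Prop :=
  ContDiff ℝ r f ∧ (∀ y, 0 < deriv f y) ∧ ∀ y, f (y + 1) = f y + 1

/-- Abstract data `(ℋ, d_ℋ, ι_ℋ)`: a space with a distance and a map into
(lifts of) `C¹` circle diffeomorphisms. -/
structure HData where
  H : Type
  dist : H → H → ℝ
  iota : H → ℝ → ℝ
  iota_lift : ∀ h, IsCrLift 1 (iota h)

noncomputable def crDist (r : ℕ) (f g : ℝ → ℝ) : ℝ :=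
  ∑ k ∈ Finset.range (r + 1), ⨆ y : ℝ, |iteratedDeriv k f y - iteratedDeriv k g y|

noncomputable def liftDist (r : ℕ) (f g : ℝ → ℝ) : ℝ :=
  crDist r f g + crDist r (Function.invFun f) (Function.invFun g)

noncomputable def liftDistInf (f g : ℝ → ℝ) : ℝ :=
  ∑' k : ℕ, (2 : ℝ)⁻¹ ^ (k + 1) * (liftDist (k + 1) f g / (liftDist (k + 1) f g + 1))

/-- Example I: `ℋ = widetilde{Diff}^r(𝕋)` with the `C^r` metric (including inverses). -/
def HData.IsExampleI (hd : HData) : Prop :=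
  ∃ r : ℕ∞, 1 ≤ r ∧ ∃ e : hd.H ≃ {f : ℝ → ℝ // IsCrLift r f},
    (∀ h, hd.iota h = (e h).1) ∧
    (∀ n : ℕ, r = (n : ℕ∞) → ∀ h h', hd.dist h h' = liftDist n (e h).1 (e h').1) ∧
    (r = ⊤ → ∀ h h', hd.dist h h' = liftDistInf (e h).1 (e h').1)

/-- `P` is (the lift of) a non-constant real-analytic function on `𝕋` with
`‖P'‖ < 1`. -/
def GoodP (P : ℝ → ℝ) : Prop :=
  AnalyticOnNhd ℝ P Set.univ ∧ (∀ y, P (y + 1) = P y) ∧ (∃ a b, P a ≠ P b) ∧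
    ∀ y, |deriv P y| < 1

/-- `P` has no smaller period. -/
def NoSmallerPeriod (P : ℝ → ℝ) : Prop :=
  ¬ ∃ ρ ∈ Set.Ioo (0 : ℝ) 1, ∀ w, P (w + ρ) = P w

/-- Example III with explicit witnesses: `ℋ = ℝ`, `ι_ℋ(h)(w) = w + P(w) + h`. -/
def HData.IsExampleIIIWith (hd : HData) (P : ℝ → ℝ) (e : hd.H ≃ ℝ) : Prop :=
  GoodP P ∧ (∀ h h', hd.dist h h' = |e h - e h'|) ∧ ∀ h y, hd.iota h y = y + P y + e h

def HData.IsExampleIII (hd : HData) : Prop := ∃ P e, hd.IsExampleIIIWith P e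

/-- Example II: Example III where moreover `P` has no smaller period. -/
def HData.IsExampleIIWith (hd : HData) (P : ℝ → ℝ) (e : hd.H ≃ ℝ) : Prop :=
  hd.IsExampleIIIWith P e ∧ NoSmallerPeriod P

def HData.IsExampleII (hd : HData) : Prop := ∃ P e, hd.IsExampleIIWith P e

/-- Continuity of `H : X → ℋ` with respect to `d_ℋ`. -/
def ContH [TopologicalSpace X] (hd : HData) (H : X → hd.H) : Prop :=
  ∀ (x : X) (ε : ℝ), 0 < ε → ∃ U ∈ nhds x, ∀ x' ∈ U, hd.dist (H x) (H x') < ε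

/-- The metric `D_ℋ` on `C⁰(X, ℋ)`. -/
noncomputable def DH (hd : HData) (H H' : X → hd.H) : ℝ :=
  ⨆ x : X, hd.dist (H x) (H' x)

/-- The lift of `Φ(H)`. -/
def Phi (hd : HData) (H : X → hd.H) : X → ℝ → ℝ := fun x => hd.iota (H x)

/-- `S` is open in `(C⁰(X,ℋ), D_ℋ)`. -/
def OpenInC0 [TopologicalSpace X] (hd : HData) (S : Set (X → hd.H)) : Prop :=
  ∀ H, ContH hd H → H ∈ S → ∃ ε : ℝ, 0 < ε ∧
    ∀ H', ContH hd H' → DH hd H H' < ε → H' ∈ S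

/-- `S` is dense in `(C⁰(X,ℋ), D_ℋ)`. -/
def DenseInC0 [TopologicalSpace X] (hd : HData) (S : Set (X → hd.H)) : Prop :=
  ∀ H, ContH hd H → ∀ ε : ℝ, 0 < ε → ∃ H', ContH hd H' ∧ DH hd H H' < ε ∧ H' ∈ S

/-- `H` lies in the closure of `𝓜𝓛(ℋ)` inside `(C⁰(X,ℋ), D_ℋ)`. -/
def InClosureML [TopologicalSpace X] (hd : HData) (g : X → X) (H : X → hd.H) : Prop :=
  ∀ ε : ℝ, 0 < ε → ∃ H', ContH hd H' ∧ DH hd H H' < ε ∧ ModeLocked g (Phi hd H')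

/-- The complement of the closure of `𝓜𝓛(ℋ)` in `C⁰(X,ℋ)`. -/
def C0NotClosML [TopologicalSpace X] (hd : HData) (g : X → X) : Set (X → hd.H) :=
  {H | ContH hd H ∧ ¬ InClosureML hd g H}

/-- Relative openness in `C⁰(X,ℋ) \ closure(𝓜𝓛(ℋ))`. -/
def OpenInCompl [TopologicalSpace X] (hd : HData) (g : X → X) (S : Set (X → hd.H)) : Prop :=
  ∀ H ∈ S ∩ C0NotClosML hd g, ∃ ε : ℝ, 0 < ε ∧
    ∀ H' ∈ C0NotClosML hd g, DH hd H H' < ε → H' ∈ S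

/-- Relative density in `C⁰(X,ℋ) \ closure(𝓜𝓛(ℋ))`. -/
def DenseInCompl [TopologicalSpace X] (hd : HData) (g : X → X) (S : Set (X → hd.H)) : Prop :=
  ∀ H ∈ C0NotClosML hd g, ∀ ε : ℝ, 0 < ε → ∃ H' ∈ C0NotClosML hd g ∩ S, DH hd H H' < ε

/-- `L` is the upper extremal fiberwise Lyapunov exponent `L₊`. -/
def HasLplus (g : X → X) (F : X → ℝ → ℝ) (L : ℝ) : Prop :=
  Tendsto (fun n : ℕ => (⨆ p : X × ℝ, Real.log (deriv (fiberIter g F n p.1) p.2)) / n)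
    atTop (nhds L)

/-- `L` is the lower extremal fiberwise Lyapunov exponent `L₋`. -/
def HasLminus (g : X → X) (F : X → ℝ → ℝ) (L : ℝ) : Prop :=
  Tendsto (fun n : ℕ => (⨅ p : X × ℝ, Real.log (deriv (fiberIter g F n p.1) p.2)) / n)
    atTop (nhds L)

/-- `‖f‖_{C^{0,1}} = sup_x max(‖Df_x‖, ‖D(f_x⁻¹)‖)`. -/
noncomputable def Cnorm (F : X → ℝ → ℝ) : ℝ :=
  ⨆ p : X × ℝ, max (deriv (F p.1) p.2) (deriv (F p.1) p.2)⁻¹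

/-- Composition of a list of maps, first element applied first. -/
def compList : List (ℝ → ℝ) → ℝ → ℝ
  | [], y => y
  | f :: l, y => compList l (f y)

/-- `ι_ℋ(h_{n-1}) ∘ ⋯ ∘ ι_ℋ(h_0)`. -/
noncomputable def tupleComp (hd : HData) {n : ℕ} (p : Fin n → hd.H) : ℝ → ℝ :=
  compList (List.ofFn fun i => hd.iota (p i))

/-- `𝐋₊` of a tuple. -/
noncomputable def bLplus (hd : HData) {n : ℕ} (p : Fin n → hd.H) : ℝ :=
  (⨆ y : ℝ, Real.log (deriv (tupleComp hd p) y)) / n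

/-- `𝐋₋` of a tuple. -/
noncomputable def bLminus (hd : HData) {n : ℕ} (p : Fin n → hd.H) : ℝ :=
  (⨅ y : ℝ, Real.log (deriv (tupleComp hd p) y)) / n

/-- The quantitative contractability condition of Example II, w.r.t. `P`. -/
def ContractableWith (g : X → X) (P : ℝ → ℝ) (F : X → ℝ → ℝ) : Prop :=
  ∃ k : ℕ, 1 < k ∧ ∀ (x : X) (w : ℝ), ∃ i : ℕ, i ≤ k - 2 ∧
    deriv (deriv P) (fiberIter g F (i + 1) x w) ≠ 0

/-- `H ∈ C⁰(X,ℋ)` is contractable. -/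
def Contractable [TopologicalSpace X] (hd : HData) (g : X → X) (H : X → hd.H) : Prop :=
  hd.IsExampleI ∨ ∃ P e, hd.IsExampleIIWith P e ∧ ContractableWith g P (Phi hd H)

/-- `F` is a lift of `Φ(H)`. -/
def IsLiftOfPhi [TopologicalSpace X] (hd : HData) (H : X → hd.H) (F : X → ℝ → ℝ) : Prop :=
  ∃ m : X → ℤ, Continuous (fun x => (m x : ℝ)) ∧ ∀ x y, F x y = hd.iota (H x) y + (m x : ℝ)

/-- `M̲(F,n)`. -/
noncomputable def Mlow (g : X → X) (F : X → ℝ → ℝ) (n : ℕ) : ℝ :=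
  ⨅ p : X × ℝ, (fiberIter g F n p.1 p.2 - p.2)

/-- `M̄(F,n)`. -/
noncomputable def Mup (g : X → X) (F : X → ℝ → ℝ) (n : ℕ) : ℝ :=
  ⨆ p : X × ℝ, (fiberIter g F n p.1 p.2 - p.2)

end ForcedCircle
namespace ForcedCircle

open AddCircle in
/-- Weyl's equidistribution theorem for irrational rotations, uniformly in the starting point. -/
theorem weyl_complex {η : ℝ} (hη : Irrational η) (f : C(AddCircle (1 : ℝ), ℂ)) {ε : ℝ}
    (hε : 0 < ε) : ∃ N : ℕ, ∀ n ≥ N, ∀ θ : AddCircle (1 : ℝ),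
      ‖∑ i ∈ Finset.range n, f (θ + i • (η : AddCircle (1 : ℝ))) - n * ∫ t, f t ∂haarAddCircle‖
        ≤ ε * n := by
  have h_int : ∀ f : C(AddCircle (1 : ℝ), ℂ), Integrable f haarAddCircle := fun f =>
    f.continuous.integrable_of_hasCompactSupport (HasCompactSupport.of_compactSpace f)
  have main : ∀ f ∈ Submodule.span ℂ (Set.range (@fourier (1 : ℝ))), ∀ ε : ℝ, 0 < ε →
      ∃ N : ℕ, ∀ n ≥ N, ∀ θ : AddCircle (1 : ℝ),
      ‖∑ i ∈ Finset.range n, f (θ + i • (η : AddCircle (1 : ℝ))) - n * ∫ t, f t ∂haarAddCircle‖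
        ≤ ε * n := by
    intro f hf
    induction hf using Submodule.span_induction with
    | mem f hf =>
      obtain ⟨k, rfl⟩ := hf
      intro ε hε
      have hI : ∫ t, fourier k t ∂haarAddCircle (T := (1 : ℝ)) = if k = 0 then 1 else 0 := by
        have := congrFun (fourierCoeff_fourier (T := (1 : ℝ)) k) 0
        simp only [fourierCoeff, neg_zero, fourier_zero, one_smul] at this
        rw [this, Pi.single_apply]
        simp [eq_comm]
      rw [hI]
      by_cases hk : k = 0
      · subst hk
        exact ⟨0, fun n _ θ => by simp; positivity⟩
      · set z : ℂ := fourier k (η : AddCircle (1 : ℝ)) with hz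
        have hz1 : z ≠ 1 := by
          rw [hz, fourier_coe_apply]
          intro h
          rw [Complex.exp_eq_one_iff] at h
          obtain ⟨m, hm⟩ := h
          have h2 : (2 * Real.pi * Complex.I : ℂ) ≠ 0 := by
            simp [Real.pi_ne_zero]
          have h3 : ((k : ℂ) * η : ℂ) = m := by
            apply mul_right_cancel₀ h2
            rw [← hm]; push_cast; ring
          have h4 : (k : ℝ) * η = m := by exact_mod_cast h3
          exact (hη.intCast_mul hk) ⟨m, by rw [h4]; simp⟩
        have hzn : ‖z‖ = 1 := by rw [hz, fourier_apply]; exact Circle.norm_coe _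
        have hpow : ∀ i : ℕ, fourier k (i • (η : AddCircle (1 : ℝ))) = z ^ i := by
          intro i
          induction i with
          | zero => simp
          | succ i ih => rw [succ_nsmul, fourier_apply, smul_add, toCircle_add, Circle.coe_mul,
              ← fourier_apply, ← fourier_apply, ih, pow_succ]
        have hadd : ∀ (θ : AddCircle (1 : ℝ)) (i : ℕ),
            fourier k (θ + i • (η : AddCircle (1 : ℝ))) = fourier k θ * z ^ i := by
          intro θ i
          rw [← hpow, fourier_apply, smul_add, toCircle_add, Circle.coe_mul, ← fourier_apply,
            ← fourier_apply]
        obtain ⟨N, hN⟩ := exists_nat_gt (2 / ‖z - 1‖ / ε)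
        have hpos : 0 < ‖z - 1‖ := norm_pos_iff.mpr (sub_ne_zero.mpr hz1)
        refine ⟨N, fun n hn θ => ?_⟩
        simp only [hk, if_false, mul_zero, sub_zero, hadd, ← Finset.mul_sum]
        rw [norm_mul, geom_sum_eq hz1, norm_div]
        have h5 : ‖(fourier k θ : ℂ)‖ = 1 := by rw [fourier_apply]; exact Circle.norm_coe _
        have h6 : ‖z ^ n - 1‖ ≤ 2 := by
          calc ‖z ^ n - 1‖ ≤ ‖z ^ n‖ + ‖(1 : ℂ)‖ := norm_sub_le _ _
            _ = 2 := by rw [norm_pow, hzn]; norm_num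
        rw [h5, one_mul]
        have h7 : (N : ℝ) ≤ n := by exact_mod_cast hn
        calc ‖z ^ n - 1‖ / ‖z - 1‖ ≤ 2 / ‖z - 1‖ := by gcongr
          _ ≤ ε * N := by rw [div_lt_iff₀ hε] at hN; linarith
          _ ≤ ε * n := by gcongr
    | zero => exact fun ε hε => ⟨0, fun n _ θ => by simp; positivity⟩
    | add f g _ _ hf hg =>
      intro ε hε
      obtain ⟨N, hN⟩ := hf (ε / 2) (by positivity)
      obtain ⟨M, hM⟩ := hg (ε / 2) (by positivity)
      refine ⟨max N M, fun n hn θ => ?_⟩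
      have h1 := hN n (le_trans (le_max_left _ _) hn) θ
      have h2 := hM n (le_trans (le_max_right _ _) hn) θ
      simp only [ContinuousMap.add_apply, Finset.sum_add_distrib]
      rw [integral_add (h_int f) (h_int g), mul_add, add_sub_add_comm]
      refine (norm_add_le _ _).trans (by linarith)
    | smul c f _ hf =>
      intro ε hε
      obtain ⟨N, hN⟩ := hf (ε / (‖c‖ + 1)) (by positivity)
      refine ⟨N, fun n hn θ => ?_⟩
      have h1 := hN n hn θ
      simp only [ContinuousMap.smul_apply, smul_eq_mul, ← Finset.mul_sum]
      rw [integral_const_mul, mul_left_comm, ← mul_sub, norm_mul]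
      calc ‖c‖ * _ ≤ (‖c‖ + 1) * (ε / (‖c‖ + 1) * n) := by gcongr; linarith
        _ = ε * n := by field_simp
  have hf : f ∈ closure ((Submodule.span ℂ (Set.range (@fourier (1 : ℝ))) : Set _)) := by
    have := span_fourier_closure_eq_top (T := (1 : ℝ))
    have h : f ∈ (Submodule.span ℂ (Set.range (@fourier (1 : ℝ)))).topologicalClosure := by
      rw [this]; trivial
    exact h
  obtain ⟨g, hg, hfg⟩ := Metric.mem_closure_iff.mp hf (ε / 3) (by positivity)
  obtain ⟨N, hN⟩ := main g hg (ε / 3) (by positivity)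
  refine ⟨N, fun n hn θ => ?_⟩
  have hd : ∀ t, ‖f t - g t‖ ≤ ε / 3 := fun t => by
    rw [← dist_eq_norm]; exact (ContinuousMap.dist_apply_le_dist t).trans hfg.le
  have h1 : ‖∑ i ∈ Finset.range n, f (θ + i • (η : AddCircle (1 : ℝ)))
      - ∑ i ∈ Finset.range n, g (θ + i • (η : AddCircle (1 : ℝ)))‖ ≤ ε / 3 * n := by
    rw [← Finset.sum_sub_distrib]
    refine (norm_sum_le_of_le _ (fun i _ => hd _)).trans ?_
    simp [mul_comm]
  have h2 : ‖(n : ℂ) * ∫ t, g t ∂haarAddCircle - n * ∫ t, f t ∂haarAddCircle‖ ≤ ε / 3 * n := by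
    rw [← mul_sub, ← integral_sub (h_int g) (h_int f), norm_mul, Complex.norm_natCast, mul_comm]
    gcongr
    refine (norm_integral_le_of_norm_le_const (C := ε / 3) (ae_of_all _ fun t => ?_)).trans ?_
    · rw [norm_sub_rev]; exact hd t
    · simp
  have h3 := hN n hn θ
  calc _ = ‖(∑ i ∈ Finset.range n, f (θ + i • (η : AddCircle (1 : ℝ)))
        - ∑ i ∈ Finset.range n, g (θ + i • (η : AddCircle (1 : ℝ))))
        + (∑ i ∈ Finset.range n, g (θ + i • (η : AddCircle (1 : ℝ)))
          - n * ∫ t, g t ∂haarAddCircle)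
        + ((n : ℂ) * ∫ t, g t ∂haarAddCircle - n * ∫ t, f t ∂haarAddCircle)‖ := by
        congr 1; ring
    _ ≤ ε / 3 * n + ε / 3 * n + ε / 3 * n :=
        (norm_add_le _ _).trans (add_le_add ((norm_add_le _ _).trans (add_le_add h1 h3)) h2)
    _ = ε * n := by ring

open AddCircle in
theorem weyl_real {η : ℝ} (hη : Irrational η) (f : C(AddCircle (1 : ℝ), ℝ)) {ε : ℝ}
    (hε : 0 < ε) : ∃ N : ℕ, ∀ n ≥ N, ∀ θ : AddCircle (1 : ℝ),
      |∑ i ∈ Finset.range n, f (θ + i • (η : AddCircle (1 : ℝ))) - n * ∫ t, f t ∂haarAddCircle|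
        ≤ ε * n := by
  obtain ⟨N, hN⟩ := weyl_complex hη ⟨fun t => (f t : ℂ), by fun_prop⟩ hε
  refine ⟨N, fun n hn θ => ?_⟩
  have h := hN n hn θ
  simp only [ContinuousMap.coe_mk] at h
  rw [integral_complex_ofReal] at h
  rw [← Real.norm_eq_abs, ← Complex.norm_real]
  push_cast
  exact h

open AddCircle in
/-- A continuous function of negative mean over an irrational rotation lies strictly below a
continuous coboundary. -/
theorem exists_lt_coboundary {ω : ℝ} (hω : Irrational ω) (a : C(AddCircle (1 : ℝ), ℝ))
    (ha : ∫ t, a t ∂haarAddCircle < 0) :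
    ∃ l : C(AddCircle (1 : ℝ), ℝ), ∀ θ, a θ < l (θ + (ω : AddCircle (1 : ℝ))) - l θ := by
  obtain ⟨N, hN⟩ := weyl_real hω a (ε := -(∫ t, a t ∂haarAddCircle) / 2) (by linarith)
  set n := N + 1 with hn
  let S : ℕ → AddCircle (1 : ℝ) → ℝ := fun m θ =>
    ∑ i ∈ Finset.range m, a (θ + i • (ω : AddCircle (1 : ℝ)))
  have hS : ∀ m θ, S m (θ + (ω : AddCircle (1 : ℝ))) = S (m + 1) θ - a θ := by
    intro m θ
    simp only [S]
    rw [Finset.sum_range_succ']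
    simp only [zero_smul, add_zero, add_sub_cancel_right]
    refine Finset.sum_congr rfl fun i _ => ?_
    rw [succ_nsmul]; congr 1; abel
  have hneg : ∀ θ, S n θ < 0 := by
    intro θ
    have h := (abs_le.mp (hN n (by omega) θ)).2
    have hn0 : (0 : ℝ) < n := by positivity
    have : (n : ℝ) * ∫ t, a t ∂haarAddCircle < 0 := mul_neg_of_pos_of_neg hn0 ha
    simp only [S]
    linarith
  have hSc : ∀ m, Continuous (S m) := fun m => by simp only [S]; fun_prop
  refine ⟨⟨fun θ => -(∑ m ∈ Finset.range n, S (m + 1) θ) / n, ?_⟩, fun θ => ?_⟩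
  · have := hSc
    fun_prop
  · simp only [ContinuousMap.coe_mk]
    have h1 : ∑ m ∈ Finset.range n, S (m + 1) (θ + (ω : AddCircle (1 : ℝ)))
        = ∑ m ∈ Finset.range n, S (m + 1) θ + S n (θ + (ω : AddCircle (1 : ℝ))) - n * a θ := by
      have h2 : ∀ k : ℕ, ∑ m ∈ Finset.range k, S (m + 1) (θ + (ω : AddCircle (1 : ℝ)))
        = ∑ m ∈ Finset.range k, S (m + 1) θ + S k (θ + (ω : AddCircle (1 : ℝ))) - k * a θ := by
        intro k
        induction k with
        | zero => simp [S]
        | succ k ih =>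
          rw [Finset.sum_range_succ, ih, Finset.sum_range_succ, hS k]
          push_cast; ring
      exact h2 n
    have hn0 : (0 : ℝ) < n := by positivity
    rw [h1, ← sub_div, lt_div_iff₀ hn0]
    have := hneg (θ + (ω : AddCircle (1 : ℝ)))
    linarith

section Lattice

variable {L : Type*} [Lattice L]

/-- If `Tp` eventually raises some `z` and the sup-preserving map `Tm ≤ Tp` eventually lowers
every point, then some `u` satisfies `Tm u ≤ u ≤ Tp u`. -/
theorem exists_between_of_sup_hom (Tp Tm : L → L) (hp : Monotone Tp)
    (hsup : ∀ a b, Tm (a ⊔ b) = Tm a ⊔ Tm b) (hle : ∀ a, Tm a ≤ Tp a) (z : L)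
    (hN : ∃ N, z ≤ Tp^[N + 1] z) (hM : ∀ b, ∃ M, Tm^[M + 1] b ≤ b) :
    ∃ u, Tm u ≤ u ∧ u ≤ Tp u := by
  obtain ⟨N, hN⟩ := hN
  let b : ℕ → L := fun n => (fun x => z ⊔ Tp x)^[n] z
  have hb : ∀ n, b (n + 1) = z ⊔ Tp (b n) := fun n => Function.iterate_succ_apply' _ _ _
  have hb1 : ∀ n, b n ≤ b (n + 1) := by
    intro n
    induction n with
    | zero => rw [hb]; exact le_sup_left
    | succ n ih => rw [hb, hb (n + 1)]; exact sup_le_sup_left (hp ih) _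
  have hb2 : ∀ n, Tp^[n] z ≤ b n := by
    intro n
    induction n with
    | zero => exact le_rfl
    | succ n ih =>
      rw [Function.iterate_succ_apply', hb]; exact (hp ih).trans le_sup_right
  obtain ⟨c, hc⟩ : ∃ c, c ≤ Tp c := by
    refine ⟨b (N + 1), ?_⟩
    have h1 : z ≤ Tp (b N) := by
      rw [Function.iterate_succ_apply'] at hN
      exact hN.trans (hp (hb2 N))
    have h2 : b (N + 1) = Tp (b N) := by rw [hb, sup_eq_right.mpr h1]
    calc b (N + 1) = Tp (b N) := h2
      _ ≤ Tp (b (N + 1)) := hp (hb1 N)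
  obtain ⟨M, hM⟩ := hM c
  let U : ℕ → L := fun n => (fun x => c ⊔ Tm x)^[n] c
  have hU : ∀ n, U (n + 1) = c ⊔ Tm (U n) := fun n => Function.iterate_succ_apply' _ _ _
  have hU1 : ∀ n, U (n + 1) = U n ⊔ Tm^[n + 1] c := by
    intro n
    induction n with
    | zero => rw [hU]; rfl
    | succ n ih =>
      rw [hU (n + 1), ih, hsup, ← sup_assoc, ← hU, ih, Function.iterate_succ_apply' Tm (n + 1)]
  have hcU : ∀ n, c ≤ U n := by
    intro n
    cases n with
    | zero => exact le_rfl
    | succ n => rw [hU]; exact le_sup_left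
  have hfix : c ⊔ Tm (U M) = U M := by
    rw [← hU, hU1]; exact sup_eq_left.mpr (hM.trans (hcU M))
  refine ⟨U M, ?_, ?_⟩
  · calc Tm (U M) ≤ c ⊔ Tm (U M) := le_sup_right
      _ = U M := hfix
  · calc U M = c ⊔ Tm (U M) := hfix.symm
      _ ≤ Tp (U M) := sup_le (hc.trans (hp (hcU M))) (hle _)

end Lattice

section Lifts

theorem fiberIter_add {X : Type*} (g : X → X) (F : X → ℝ → ℝ) (m n : ℕ) (x : X) (y : ℝ) :
    fiberIter g F (m + n) x y = fiberIter g F m (g^[n] x) (fiberIter g F n x y) := by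
  induction m with
  | zero => simp [fiberIter]
  | succ m ih =>
    rw [show m + 1 + n = (m + n) + 1 by ring, fiberIter, fiberIter, ih,
      Function.iterate_add_apply]

variable {X : Type*} [TopologicalSpace X] {g : X → X}

theorem ForcedLift.continuous_iter (F : ForcedLift g) (hg : Continuous g) (n : ℕ) :
    Continuous fun p : X × ℝ => fiberIter g F.F n p.1 p.2 := by
  induction n with
  | zero => exact continuous_snd
  | succ n ih =>
    exact F.cont.comp (((hg.iterate n).comp continuous_fst).prodMk ih)

theorem ForcedLift.iter_strictMono (F : ForcedLift g) (n : ℕ) (x : X) :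
    StrictMono (fiberIter g F.F n x) := by
  induction n with
  | zero => exact strictMono_id
  | succ n ih => exact (F.mono _).comp ih

theorem ForcedLift.add_int (F : ForcedLift g) (x : X) (y : ℝ) (m : ℤ) :
    F.F x (y + m) = F.F x y + m := by
  induction m using Int.induction_on with
  | zero => simp
  | succ i ih =>
    push_cast at ih ⊢
    rw [← add_assoc, F.periodic, ih]; ring
  | pred i ih =>
    push_cast at ih ⊢
    have := F.periodic x (y + (-(i : ℝ) - 1))
    rw [show y + (-(i : ℝ) - 1) + 1 = y + -i by ring, ih] at this
    linarith

theorem ForcedLift.iter_add_int (F : ForcedLift g) (n : ℕ) (x : X) (y : ℝ) (m : ℤ) :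
    fiberIter g F.F n x (y + m) = fiberIter g F.F n x y + m := by
  induction n with
  | zero => rfl
  | succ n ih => rw [fiberIter, ih, F.add_int, fiberIter]

/-- Conjugation of a lift by the reflection `y ↦ -y`. -/
def ForcedLift.reflect (F : ForcedLift g) : ForcedLift g where
  F x y := -F.F x (-y)
  cont := by
    have := F.cont.comp (continuous_fst.prodMk continuous_snd.neg : Continuous fun p : X × ℝ =>
      (p.1, -p.2))
    exact this.neg
  mono x y z h := neg_lt_neg (F.mono x (neg_lt_neg h))
  surj x y := by
    obtain ⟨z, hz⟩ := F.surj x (-y)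
    exact ⟨-z, by simp [hz]⟩
  periodic x y := by
    have := F.periodic x (-(y + 1))
    rw [show -(y + 1) + 1 = -y by ring] at this
    rw [this]; ring

theorem ForcedLift.reflect_iter (F : ForcedLift g) (n : ℕ) (x : X) (y : ℝ) :
    fiberIter g F.reflect.F n x y = -fiberIter g F.F n x (-y) := by
  induction n with
  | zero => simp [fiberIter]
  | succ n ih => simp only [fiberIter]; rw [ih]; simp [ForcedLift.reflect]

/-- The action of a lift over a homeomorphism on continuous curves. -/
def ForcedLift.graphMap {g : X ≃ₜ X} (F : ForcedLift g) (u : C(X, ℝ)) : C(X, ℝ) :=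
  ⟨fun x => F.F (g.symm x) (u (g.symm x)),
    F.cont.comp (g.symm.continuous.prodMk (u.continuous.comp g.symm.continuous))⟩

theorem ForcedLift.graphMap_iter {g : X ≃ₜ X} (F : ForcedLift g) (u : C(X, ℝ)) (n : ℕ) (x : X) :
    (F.graphMap^[n] u) (g^[n] x) = fiberIter g F.F n x (u x) := by
  induction n with
  | zero => rfl
  | succ n ih =>
    rw [Function.iterate_succ_apply', Function.iterate_succ_apply' g, fiberIter, ← ih]
    simp [ForcedLift.graphMap]

variable [CompactSpace X]

/-- If every fibre is raised by more than `1` at some time, all fibres are raised uniformly. -/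
theorem ForcedLift.uniform_drift_up (F : ForcedLift g) (hg : Continuous g)
    (h : ∀ x, ∃ n, 1 < fiberIter g F.F n x 0) (C : ℝ) :
    ∃ N, ∀ x, C ≤ fiberIter g F.F (N + 1) x 0 := by
  have hc : ∀ n, Continuous fun x => fiberIter g F.F n x 0 := fun n =>
    (F.continuous_iter hg n).comp (continuous_id.prodMk continuous_const)
  obtain ⟨t, ht⟩ := isCompact_univ.elim_finite_subcover
    (fun n : ℕ => {x | 1 < fiberIter g F.F n x 0})
    (fun n => isOpen_lt continuous_const (hc n))
    (fun x _ => Set.mem_iUnion.mpr (h x))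
  set M := t.sup id + 1 with hM
  have hret : ∀ x, ∃ i ≤ M, 1 < fiberIter g F.F i x 0 := by
    intro x
    obtain ⟨i, hi, hx⟩ := Set.mem_iUnion₂.mp (ht (Set.mem_univ x))
    exact ⟨i, (Finset.le_sup (f := id) hi).trans (Nat.le_succ _), hx⟩
  have hM0 : (0 : ℝ) < M := by positivity
  have hbd : ∀ n, ∃ K : ℝ, ∀ x, -K ≤ fiberIter g F.F n x 0 := by
    intro n
    obtain ⟨K, hK⟩ := isCompact_univ.exists_bound_of_continuousOn (hc n).continuousOn
    exact ⟨K, fun x => (abs_le.mp (hK x trivial)).1⟩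
  choose K hK using hbd
  set B := ∑ n ∈ Finset.range M, |K n| with hB
  have main : ∀ (n : ℕ) x, (n : ℝ) / M - (B + 1) ≤ fiberIter g F.F n x 0 := by
    intro n
    induction n using Nat.strong_induction_on with
    | _ n ih =>
      intro x
      by_cases hn : n < M
      · have h1 : (n : ℝ) / M ≤ 1 := by
          rw [div_le_one hM0]; exact_mod_cast hn.le
        have h2 : |K n| ≤ B := Finset.single_le_sum (f := fun n => |K n|)
          (fun _ _ => abs_nonneg _) (Finset.mem_range.mpr hn)
        have := hK n x
        have := le_abs_self (K n)
        linarith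
      · obtain ⟨i, hiM, hi⟩ := hret x
        have hi0 : i ≠ 0 := by
          rintro rfl; simp only [fiberIter] at hi; linarith
        have hin : n = (n - i) + i := by omega
        have h1 := ih (n - i) (by omega) (g^[i] x)
        rw [hin, fiberIter_add]
        have h2 := (F.iter_strictMono (n - i) (g^[i] x)) hi
        have h3 := F.iter_add_int (n - i) (g^[i] x) 0 1
        push_cast at h3
        rw [zero_add] at h3
        rw [h3] at h2
        have h4 : ((n - i + i : ℕ) : ℝ) / M ≤ ((n - i : ℕ) : ℝ) / M + 1 := by
          rw [Nat.cast_add, add_div]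
          gcongr
          rw [div_le_one hM0]; exact_mod_cast hiM
        linarith
  obtain ⟨N, hN⟩ := exists_nat_gt (M * (C + B + 1))
  refine ⟨N, fun x => le_trans ?_ (main (N + 1) x)⟩
  rw [le_sub_iff_add_le, le_div_iff₀ hM0]
  push_cast
  nlinarith

theorem ForcedLift.uniform_drift_down (F : ForcedLift g) (hg : Continuous g)
    (h : ∀ x, ∃ n, fiberIter g F.F n x 0 < -1) (C : ℝ) :
    ∃ N, ∀ x, fiberIter g F.F (N + 1) x 0 ≤ C := by
  obtain ⟨N, hN⟩ := F.reflect.uniform_drift_up hg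
    (fun x => by
      obtain ⟨n, hn⟩ := h x
      exact ⟨n, by rw [F.reflect_iter, neg_zero]; linarith⟩) (-C)
  refine ⟨N, fun x => ?_⟩
  have := hN x
  rw [F.reflect_iter, neg_zero] at this
  linarith

/-- If `Fp` drifts upwards, `Fm` drifts downwards and `Fm ≤ Fp`, there is a continuous curve
whose image lies between its images under `Fm` and `Fp`. -/
theorem exists_curve_between {g : X ≃ₜ X} (Fp Fm : ForcedLift g)
    (hle : ∀ x y, Fm.F x y ≤ Fp.F x y)
    (hp : ∀ x, ∃ n, 1 < fiberIter g Fp.F n x 0)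
    (hm : ∀ x, ∃ n, fiberIter g Fm.F n x 0 < -1) :
    ∃ u : C(X, ℝ), ∀ x, Fm.F x (u x) ≤ u (g x) ∧ u (g x) ≤ Fp.F x (u x) := by
  obtain ⟨u, h1, h2⟩ := exists_between_of_sup_hom Fp.graphMap Fm.graphMap
    (fun a b hab => ContinuousMap.le_def.mpr fun x =>
      (Fp.mono _).monotone (ContinuousMap.le_def.mp hab _))
    (fun a b => by
      ext x
      exact (Fm.mono _).monotone.map_sup _ _)
    (fun a => ContinuousMap.le_def.mpr fun x => hle _ _) 0
    (by
      obtain ⟨N, hN⟩ := Fp.uniform_drift_up g.continuous hp 0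
      refine ⟨N, ContinuousMap.le_def.mpr fun x => ?_⟩
      obtain ⟨z, rfl⟩ := (g.surjective.iterate (N + 1)) x
      rw [Fp.graphMap_iter]
      exact hN z)
    (by
      intro b
      obtain ⟨K, hK⟩ := exists_nat_gt ‖b‖
      have hbK : ∀ x, |b x| ≤ K := fun x => (b.norm_coe_le_norm x).trans hK.le
      obtain ⟨N, hN⟩ := Fm.uniform_drift_down g.continuous hm (-(2 * K))
      refine ⟨N, ContinuousMap.le_def.mpr fun x => ?_⟩
      obtain ⟨z, rfl⟩ := (g.surjective.iterate (N + 1)) x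
      rw [Fm.graphMap_iter]
      have h3 := (Fm.iter_strictMono (N + 1) z).monotone (abs_le.mp (hbK z)).2
      have h4 := Fm.iter_add_int (N + 1) z 0 K
      push_cast at h4
      rw [zero_add] at h4
      have h5 := hN z
      have h6 := (abs_le.mp (hbK (g^[N + 1] z))).1
      linarith)
  refine ⟨u, fun x => ?_⟩
  have h3 := ContinuousMap.le_def.mp h1 (g x)
  have h4 := ContinuousMap.le_def.mp h2 (g x)
  simp only [ForcedLift.graphMap, ContinuousMap.coe_mk, Homeomorph.symm_apply_apply] at h3 h4
  exact ⟨h3, h4⟩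

end Lifts

theorem rotation_iterate (a θ : AddCircle (1 : ℝ)) (n : ℕ) :
    (fun t : AddCircle (1 : ℝ) => t + a)^[n] θ = θ + n • a := by
  induction n with
  | zero => simp
  | succ n ih => rw [Function.iterate_succ_apply', ih, succ_nsmul]; abel

theorem ForcedLift.abs_iter_sub_le {X : Type*} [TopologicalSpace X] {g : X → X}
    (F : ForcedLift g) (n : ℕ) (x : X) (y : ℝ) :
    |fiberIter g F.F n x y - y - fiberIter g F.F n x 0| ≤ 1 := by
  have hm := (F.iter_strictMono n x).monotone
  have h1 := hm (Int.floor_le y)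
  have h2 := hm (Int.lt_floor_add_one y).le
  have h3 := F.iter_add_int n x 0 ⌊y⌋
  have h4 := F.iter_add_int n x 0 (⌊y⌋ + 1)
  push_cast at h4
  rw [zero_add] at h3 h4
  rw [h3] at h1
  rw [h4] at h2
  have h5 := Int.floor_le y
  have h6 := Int.lt_floor_add_one y
  rw [abs_le]
  constructor <;> linarith

open AddCircle in
/-- Existence of the fibered rotation number over an irrational rotation. -/
theorem ForcedLift.exists_hasRotNum {ω : ℝ} (hω : Irrational ω)
    {g : AddCircle (1 : ℝ) → AddCircle (1 : ℝ)}
    (hg : g = fun θ => θ + (ω : AddCircle (1 : ℝ))) (F : ForcedLift g) :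
    ∃ ρ, HasRotNum g F.F ρ := by
  have hgc : Continuous g := by rw [hg]; fun_prop
  have hiter : ∀ (n : ℕ) x, g^[n] x = x + n • (ω : AddCircle (1 : ℝ)) := fun n x => by
    rw [hg, rotation_iterate]
  let a : ℕ → C(AddCircle (1 : ℝ), ℝ) := fun n =>
    ⟨fun x => fiberIter g F.F n x 0,
      (F.continuous_iter hgc n).comp (continuous_id.prodMk continuous_const)⟩
  have ha : ∀ n x, a n x = fiberIter g F.F n x 0 := fun _ _ => rfl
  have hadd : ∀ m n x, |a (m + n) x - a n x - a m (x + n • (ω : AddCircle (1 : ℝ)))| ≤ 1 := by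
    intro m n x
    rw [ha, ha, ha, fiberIter_add, hiter]
    exact F.abs_iter_sub_le _ _ _
  have hsum : ∀ n k x, |a (n * k) x
      - ∑ i ∈ Finset.range k, a n (x + i • ((n * ω : ℝ) : AddCircle (1 : ℝ)))| ≤ k := by
    intro n k x
    induction k with
    | zero => simp [ha, fiberIter]
    | succ k ih =>
      rw [Finset.sum_range_succ, mul_add, mul_one, add_comm (n * k) n]
      have h1 := hadd n (n * k) x
      have h2 : (n * k) • (ω : AddCircle (1 : ℝ)) = k • ((n * ω : ℝ) : AddCircle (1 : ℝ)) := by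
        rw [← nsmul_eq_mul, AddCircle.coe_nsmul, ← mul_nsmul]
      rw [h2] at h1
      rw [abs_le] at *
      push_cast
      constructor <;> linarith
  have key : ∀ n : ℕ, 0 < n → ∃ c : ℝ, ∃ N₀ : ℕ, ∀ N ≥ N₀, ∀ x, |a N x / N - c| ≤ 3 / n := by
    intro n hn
    have hn0 : (0 : ℝ) < n := by exact_mod_cast hn
    set c := ∫ t, a n t ∂haarAddCircle with hc
    obtain ⟨K, hK⟩ := weyl_real (hω.natCast_mul hn.ne') (a n) one_pos
    set B := ∑ r ∈ Finset.range n, ‖a r‖ with hB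
    obtain ⟨N₁, hN₁⟩ := exists_nat_gt (n * (1 + B + |c|))
    refine ⟨c / n, max (n * K) (N₁ + 1), fun N hN x => ?_⟩
    have hNK : n * K ≤ N := (le_max_left _ _).trans hN
    have hNN : N₁ + 1 ≤ N := (le_max_right _ _).trans hN
    have hN0 : (0 : ℝ) < N := by
      have : 0 < N := by omega
      exact_mod_cast this
    have hNN' : (N₁ : ℝ) ≤ N := by
      have : N₁ ≤ N := by omega
      exact_mod_cast this
    set k := N / n with hk
    set r := N % n with hr
    have hrn : r < n := Nat.mod_lt _ hn
    have hNkr : r + n * k = N := Nat.mod_add_div N n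
    have hkK : K ≤ k := by rw [hk, Nat.le_div_iff_mul_le hn]; linarith
    have h1 := hadd r (n * k) x
    rw [hNkr] at h1
    have h2 := hsum n k x
    have h3 := hK k hkK x
    rw [one_mul] at h3
    have h4 : |a r (x + (n * k) • (ω : AddCircle (1 : ℝ)))| ≤ B :=
      ((a r).norm_coe_le_norm _).trans (Finset.single_le_sum (f := fun r => ‖a r‖)
        (fun _ _ => norm_nonneg _) (Finset.mem_range.mpr hrn))
    have h5 : |a N x - k * c| ≤ 2 * k + 1 + B := by
      rw [abs_le] at *
      constructor <;> linarith
    have hNR : (N : ℝ) = r + n * k := by rw [← hNkr]; push_cast; ring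
    have h6 : |(r : ℝ) / n * c| ≤ |c| := by
      rw [abs_mul, abs_of_nonneg (by positivity)]
      have : (r : ℝ) / n ≤ 1 := by
        rw [div_le_one hn0]; exact_mod_cast hrn.le
      nlinarith [abs_nonneg c]
    have h7 : (N : ℝ) * (c / n) = k * c + r / n * c := by
      rw [hNR, add_mul, add_comm, mul_right_comm, mul_div_cancel₀ _ hn0.ne',
        mul_comm c, div_mul_eq_mul_div, mul_div_assoc]
    have h8 : |a N x - N * (c / n)| ≤ 2 * k + 1 + B + |c| := by
      rw [h7, ← sub_sub]
      exact (abs_sub _ _).trans (add_le_add h5 h6)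
    have h9 : a N x / N - c / n = (a N x - N * (c / n)) / N := by
      field_simp
    rw [h9, abs_div, abs_of_pos hN0, div_le_div_iff₀ hN0 hn0]
    have h10 : (n : ℝ) * k ≤ N := by rw [hNR]; linarith [(Nat.cast_nonneg r : (0 : ℝ) ≤ r)]
    nlinarith
  have hC : CauchySeq fun N : ℕ => a N 0 / N := by
    rw [Metric.cauchySeq_iff']
    intro ε hε
    obtain ⟨n, hn⟩ := exists_nat_gt (6 / ε)
    have hn0 : (0 : ℝ) < n := lt_trans (by positivity) hn
    obtain ⟨c, N₀, hN₀⟩ := key n (by exact_mod_cast hn0)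
    refine ⟨N₀, fun N hN => ?_⟩
    have h1 := hN₀ N hN 0
    have h2 := hN₀ N₀ le_rfl 0
    have h3 : 3 / (n : ℝ) + 3 / n < ε := by
      rw [div_lt_iff₀ hε] at hn
      rw [← add_div, div_lt_iff₀ hn0]; linarith
    rw [Real.dist_eq]
    rw [abs_sub_comm] at h2
    calc _ = |(a N 0 / N - c) + (c - a N₀ 0 / N₀)| := by congr 1; ring
      _ ≤ _ := abs_add_le _ _
      _ < ε := by linarith
  obtain ⟨ρ, hρ⟩ := cauchySeq_tendsto_of_complete hC
  refine ⟨ρ, fun x y => ?_⟩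
  have hd : Tendsto (fun N : ℕ => (a N x / N - a N 0 / N)
      + (fiberIter g F.F N x y - y - a N x) / N) atTop (𝓝 0) := by
    rw [Metric.tendsto_atTop]
    intro ε hε
    obtain ⟨n, hn⟩ := exists_nat_gt (7 / ε)
    have hn0 : (0 : ℝ) < n := lt_trans (by positivity) hn
    obtain ⟨c, N₀, hN₀⟩ := key n (by exact_mod_cast hn0)
    refine ⟨max N₀ n, fun N hN => ?_⟩
    have hN0 := (le_max_left _ _).trans hN
    have hNn : (n : ℝ) ≤ N := by exact_mod_cast (le_max_right _ _).trans hN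
    have h1 := hN₀ N hN0 0
    have h2 := hN₀ N hN0 x
    have h3 : 3 / (n : ℝ) + 3 / n + 1 / n < ε := by
      rw [div_lt_iff₀ hε] at hn
      rw [← add_div, ← add_div, div_lt_iff₀ hn0]; linarith
    have h4 : |(fiberIter g F.F N x y - y - a N x) / N| ≤ 1 / n := by
      rw [abs_div, Nat.abs_cast]
      exact div_le_div₀ zero_le_one (F.abs_iter_sub_le N x y) hn0 hNn
    rw [Real.dist_eq, sub_zero]
    rw [abs_le] at h1 h2 h4
    rw [abs_lt]
    constructor <;> linarith
  have := hρ.add hd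
  rw [add_zero] at this
  refine this.congr fun N => ?_
  ring

section

/-- `x ↦ sin (2πx)` on `𝕋`. -/
noncomputable def circSin : C(AddCircle (1 : ℝ), ℝ) :=
  ⟨fun x => (fourier 1 x : ℂ).im, by fun_prop⟩

/-- `x ↦ cos (2πx)` on `𝕋`. -/
noncomputable def circCos : C(AddCircle (1 : ℝ), ℝ) :=
  ⟨fun x => (fourier 1 x : ℂ).re, by fun_prop⟩

theorem circSin_coe (y : ℝ) : circSin (y : AddCircle (1 : ℝ)) = Real.sin (2 * Real.pi * y) := by
  simp only [circSin, ContinuousMap.coe_mk, fourier_coe_apply]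
  rw [← Complex.exp_ofReal_mul_I_im]
  congr 2; push_cast; ring

theorem circCos_coe (y : ℝ) : circCos (y : AddCircle (1 : ℝ)) = Real.cos (2 * Real.pi * y) := by
  simp only [circCos, ContinuousMap.coe_mk, fourier_coe_apply]
  rw [← Complex.exp_ofReal_mul_I_re]
  congr 2; push_cast; ring

theorem exists_coe_eq (x : AddCircle (1 : ℝ)) : ∃ z : ℝ, (z : AddCircle (1 : ℝ)) = x :=
  QuotientAddGroup.mk_surjective x

theorem abs_circSin_le_one (x : AddCircle (1 : ℝ)) : |circSin x| ≤ 1 := by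
  obtain ⟨z, rfl⟩ := exists_coe_eq x
  rw [circSin_coe]; exact Real.abs_sin_le_one _

theorem abs_circCos_le_one (x : AddCircle (1 : ℝ)) : |circCos x| ≤ 1 := by
  obtain ⟨z, rfl⟩ := exists_coe_eq x
  rw [circCos_coe]; exact Real.abs_cos_le_one _

theorem abs_circSin_sub_le (x : AddCircle (1 : ℝ)) (v w : ℝ) :
    |circSin (x + (v : AddCircle (1 : ℝ))) - circSin (x + (w : AddCircle (1 : ℝ)))|
      ≤ 2 * Real.pi * |v - w| := by
  obtain ⟨z, rfl⟩ := exists_coe_eq x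
  rw [← AddCircle.coe_add, ← AddCircle.coe_add, circSin_coe, circSin_coe]
  refine (Real.abs_sin_sub_sin_le _ _).trans_eq ?_
  rw [← mul_sub, abs_mul, abs_of_pos Real.two_pi_pos]
  congr 2; ring

variable {g : AddCircle (1 : ℝ) → AddCircle (1 : ℝ)} {α : ℝ}

theorem abs_scaled_circSin_sub_le (hα : α ∈ Set.Ioo (0 : ℝ) 1) (x : AddCircle (1 : ℝ)) (v w : ℝ) :
    |α / (2 * Real.pi) * circSin (x + (v : AddCircle (1 : ℝ)))
      - α / (2 * Real.pi) * circSin (x + (w : AddCircle (1 : ℝ)))| ≤ α * |v - w| := by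
  have h0 := hα.1
  have hpi := Real.two_pi_pos
  rw [← mul_sub, abs_mul, abs_of_pos (by positivity)]
  calc _ ≤ α / (2 * Real.pi) * (2 * Real.pi * |v - w|) := by
        gcongr; exact abs_circSin_sub_le _ _ _
    _ = _ := by field_simp

/-- The lift of the forced Arnold circle map with forcing `h`, seen in the coordinate
`w = y - k θ` and slowed down by `r`. -/
noncomputable def arnoldLift (g : AddCircle (1 : ℝ) → AddCircle (1 : ℝ))
    (hα : α ∈ Set.Ioo (0 : ℝ) 1) (k : ℤ) (r : ℝ) (h : C(AddCircle (1 : ℝ), ℝ)) :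
    ForcedLift g where
  F θ w := w + α / (2 * Real.pi) * circSin (k • θ + (w : AddCircle (1 : ℝ))) + h θ - r
  cont := by
    have : Continuous fun p : AddCircle (1 : ℝ) × ℝ => (p.2 : AddCircle (1 : ℝ)) :=
      (AddCircle.continuous_mk' 1).comp continuous_snd
    fun_prop
  mono θ v w hvw := by
    have h1 := abs_scaled_circSin_sub_le hα (k • θ) v w
    rw [abs_of_neg (sub_neg.mpr hvw)] at h1
    have h2 := (abs_le.mp h1).2
    have h3 := hα.2
    have h4 : 0 < (1 - α) * (w - v) := mul_pos (by linarith) (by linarith)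
    simp only
    linarith
  surj θ y := by
    have h0 := hα.1
    have hpi := Real.two_pi_pos
    have hb : ∀ w : ℝ, |α / (2 * Real.pi) * circSin (k • θ + (w : AddCircle (1 : ℝ)))|
        ≤ α / (2 * Real.pi) := by
      intro w
      rw [abs_mul, abs_of_pos (by positivity)]
      exact mul_le_of_le_one_right (by positivity) (abs_circSin_le_one _)
    have hc : Continuous fun w : ℝ =>
        w + α / (2 * Real.pi) * circSin (k • θ + (w : AddCircle (1 : ℝ))) + h θ - r := by
      have : Continuous fun w : ℝ => (w : AddCircle (1 : ℝ)) := AddCircle.continuous_mk' 1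
      fun_prop
    refine mem_range_of_exists_le_of_exists_ge hc
      ⟨y - h θ + r - α / (2 * Real.pi), ?_⟩ ⟨y - h θ + r + α / (2 * Real.pi), ?_⟩
    · have := (abs_le.mp (hb (y - h θ + r - α / (2 * Real.pi)))).2
      linarith
    · have := (abs_le.mp (hb (y - h θ + r + α / (2 * Real.pi)))).1
      linarith
  periodic θ y := by
    have : ((y + 1 : ℝ) : AddCircle (1 : ℝ)) = y := by
      rw [AddCircle.coe_add, AddCircle.coe_period, add_zero]
    rw [this]; ring

theorem arnoldLift_apply (hα : α ∈ Set.Ioo (0 : ℝ) 1) (k : ℤ) (r : ℝ)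
    (h : C(AddCircle (1 : ℝ), ℝ)) (θ : AddCircle (1 : ℝ)) (w : ℝ) :
    (arnoldLift g hα k r h).F θ w
      = w + α / (2 * Real.pi) * circSin (k • θ + (w : AddCircle (1 : ℝ))) + h θ - r := rfl

theorem arnoldLift_add (hα : α ∈ Set.Ioo (0 : ℝ) 1) {k : ℤ} (r : ℝ)
    (h : C(AddCircle (1 : ℝ), ℝ)) {θ : AddCircle (1 : ℝ)} (w : ℝ) {z : ℝ}
    (hz : (z : AddCircle (1 : ℝ)) = k • θ) :
    (arnoldLift g hα 0 0 h).F θ (w + z) = (arnoldLift g hα k r h).F θ w + z + r := by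
  rw [arnoldLift_apply, arnoldLift_apply, AddCircle.coe_add, hz, zero_smul, zero_add,
    add_comm (w : AddCircle (1 : ℝ))]
  ring

theorem arnoldLift_add_const (hα : α ∈ Set.Ioo (0 : ℝ) 1) (k : ℤ) (r c : ℝ)
    (h : C(AddCircle (1 : ℝ), ℝ)) (θ : AddCircle (1 : ℝ)) (w : ℝ) :
    (arnoldLift g hα k r (h + ContinuousMap.const _ c)).F θ w
      = (arnoldLift g hα k r h).F θ w + c := by
  simp only [arnoldLift_apply, ContinuousMap.add_apply, ContinuousMap.const_apply]; ring

variable {ω : ℝ}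

theorem coe_add_nsmul_of_coe {k : ℤ} {r z : ℝ} {θ : AddCircle (1 : ℝ)}
    (hr : (r : AddCircle (1 : ℝ)) = k • (ω : AddCircle (1 : ℝ)))
    (hz : (z : AddCircle (1 : ℝ)) = k • θ) (n : ℕ) :
    ((z + n * r : ℝ) : AddCircle (1 : ℝ)) = k • (θ + n • (ω : AddCircle (1 : ℝ))) := by
  rw [AddCircle.coe_add, ← nsmul_eq_mul, AddCircle.coe_nsmul, hz, hr, smul_add, smul_comm]

theorem arnoldLift_iter_add (hg : g = fun θ => θ + (ω : AddCircle (1 : ℝ)))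
    (hα : α ∈ Set.Ioo (0 : ℝ) 1) {k : ℤ} {r : ℝ}
    (hr : (r : AddCircle (1 : ℝ)) = k • (ω : AddCircle (1 : ℝ)))
    (h : C(AddCircle (1 : ℝ), ℝ)) {θ : AddCircle (1 : ℝ)} (w : ℝ) {z : ℝ}
    (hz : (z : AddCircle (1 : ℝ)) = k • θ) (n : ℕ) :
    fiberIter g (arnoldLift g hα 0 0 h).F n θ (w + z)
      = fiberIter g (arnoldLift g hα k r h).F n θ w + (z + n * r) := by
  induction n with
  | zero => simp [fiberIter]
  | succ n ih =>
    have hgn : g^[n] θ = θ + n • (ω : AddCircle (1 : ℝ)) := by rw [hg, rotation_iterate]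
    rw [fiberIter, fiberIter, ih, arnoldLift_add hα r h _
      (by rw [hgn]; exact coe_add_nsmul_of_coe hr hz n)]
    push_cast; ring

theorem ForcedLift.iter_le_of_le {X : Type*} [TopologicalSpace X] {g : X → X}
    (F H : ForcedLift g) (m : ℤ) (hle : ∀ x y, H.F x y ≤ F.F x y + m) (n : ℕ) (x : X) (y : ℝ) :
    fiberIter g H.F n x y ≤ fiberIter g F.F n x y + n * m := by
  induction n with
  | zero => simp [fiberIter]
  | succ n ih =>
    have h1 := (H.mono (g^[n] x)).monotone ih
    have h2 := hle (g^[n] x) (fiberIter g F.F n x y + n * m)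
    have h3 := F.add_int (g^[n] x) (fiberIter g F.F n x y) (n * m)
    push_cast at h3
    rw [h3] at h2
    simp only [fiberIter]
    push_cast
    linarith

theorem ForcedLift.le_iter_of_le {X : Type*} [TopologicalSpace X] {g : X → X}
    (F H : ForcedLift g) (m : ℤ) (hle : ∀ x y, F.F x y + m ≤ H.F x y) (n : ℕ) (x : X) (y : ℝ) :
    fiberIter g F.F n x y + n * m ≤ fiberIter g H.F n x y := by
  have := H.iter_le_of_le F (-m) (fun x y => by push_cast; linarith [hle x y]) n x y
  push_cast at this
  linarith

theorem arnoldLift_drift_up (hg : g = fun θ => θ + (ω : AddCircle (1 : ℝ)))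
    (hα : α ∈ Set.Ioo (0 : ℝ) 1) {k : ℤ} {r : ℝ}
    (hr : (r : AddCircle (1 : ℝ)) = k • (ω : AddCircle (1 : ℝ)))
    (h : C(AddCircle (1 : ℝ), ℝ)) (H : ForcedLift g) {ρ : ℝ} {m : ℤ}
    (hle : ∀ x y, H.F x y ≤ (arnoldLift g hα 0 0 h).F x y + m) (hρ : HasRotNum g H.F ρ)
    (hlt : r + m < ρ) (θ : AddCircle (1 : ℝ)) :
    ∃ n, 1 < fiberIter g (arnoldLift g hα k r h).F n θ 0 := by
  obtain ⟨z, hz⟩ := exists_coe_eq (k • θ)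
  obtain ⟨c, hc1, hc2⟩ := exists_between hlt
  obtain ⟨N, hN⟩ := exists_nat_gt (1 / (c - (r + m)))
  obtain ⟨n, hn, hnN⟩ := (((hρ θ z).eventually (lt_mem_nhds hc2)).and
    (eventually_ge_atTop (N + 1))).exists
  have hn0 : (0 : ℝ) < n := by
    have : 0 < n := by omega
    exact_mod_cast this
  have hNn : (N : ℝ) ≤ n := by exact_mod_cast (Nat.le_succ N).trans hnN
  refine ⟨n, ?_⟩
  rw [lt_div_iff₀ hn0] at hn
  rw [div_lt_iff₀ (by linarith)] at hN
  have h1 := ForcedLift.iter_le_of_le _ H m hle n θ z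
  have h2 := arnoldLift_iter_add hg hα hr h 0 hz n
  rw [zero_add] at h2
  rw [h2] at h1
  nlinarith

theorem arnoldLift_drift_down (hg : g = fun θ => θ + (ω : AddCircle (1 : ℝ)))
    (hα : α ∈ Set.Ioo (0 : ℝ) 1) {k : ℤ} {r : ℝ}
    (hr : (r : AddCircle (1 : ℝ)) = k • (ω : AddCircle (1 : ℝ)))
    (h : C(AddCircle (1 : ℝ), ℝ)) (H : ForcedLift g) {ρ : ℝ} {m : ℤ}
    (hle : ∀ x y, (arnoldLift g hα 0 0 h).F x y + m ≤ H.F x y) (hρ : HasRotNum g H.F ρ)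
    (hlt : ρ < r + m) (θ : AddCircle (1 : ℝ)) :
    ∃ n, fiberIter g (arnoldLift g hα k r h).F n θ 0 < -1 := by
  obtain ⟨z, hz⟩ := exists_coe_eq (k • θ)
  obtain ⟨c, hc1, hc2⟩ := exists_between hlt
  obtain ⟨N, hN⟩ := exists_nat_gt (1 / ((r + m) - c))
  obtain ⟨n, hn, hnN⟩ := (((hρ θ z).eventually (gt_mem_nhds hc1)).and
    (eventually_ge_atTop (N + 1))).exists
  have hn0 : (0 : ℝ) < n := by
    have : 0 < n := by omega
    exact_mod_cast this
  have hNn : (N : ℝ) ≤ n := by exact_mod_cast (Nat.le_succ N).trans hnN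
  refine ⟨n, ?_⟩
  rw [div_lt_iff₀ hn0] at hn
  rw [div_lt_iff₀ (by linarith)] at hN
  have h1 := ForcedLift.le_iter_of_le _ H m hle n θ z
  have h2 := arnoldLift_iter_add hg hα hr h 0 hz n
  rw [zero_add] at h2
  rw [h2] at h1
  nlinarith

theorem exists_int_const {Y : Type*} [TopologicalSpace Y] [PreconnectedSpace Y] {D : Y → ℝ}
    (hD : Continuous D) {δ : ℝ} (hδ : δ ≤ 1 / 4) (h : ∀ y, ∃ m : ℤ, |D y - m| < δ) :
    ∃ m : ℤ, ∀ y, |D y - m| < δ := by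
  rcases isEmpty_or_nonempty Y with hY | ⟨⟨y₀⟩⟩
  · exact ⟨0, fun y => (hY.false y).elim⟩
  have key : ∀ x y (m n : ℤ), |D x - m| < δ → |D y - n| < δ → n ≤ m := by
    intro x y m n hx hy
    by_contra! hmn
    have h1 : (m : ℝ) + 1 ≤ n := by exact_mod_cast hmn
    rw [abs_lt] at hx hy
    obtain ⟨t, ht⟩ := mem_range_of_exists_le_of_exists_ge hD (c := (m : ℝ) + 1 / 2)
      ⟨x, by linarith⟩ ⟨y, by linarith⟩
    obtain ⟨p, hp⟩ := h t
    rw [ht, abs_lt] at hp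
    rcases le_or_gt p m with h2 | h2
    · have : (p : ℝ) ≤ m := by exact_mod_cast h2
      linarith
    · have : (m : ℝ) + 1 ≤ p := by exact_mod_cast h2
      linarith
  obtain ⟨m, hm⟩ := h y₀
  refine ⟨m, fun y => ?_⟩
  obtain ⟨n, hn⟩ := h y
  rw [le_antisymm (key _ _ _ _ hn hm) (key _ _ _ _ hm hn)]
  exact hn

theorem ForcedLift.exists_int_close {X : Type*} [TopologicalSpace X] [PreconnectedSpace X]
    {g : X → X} (F H : ForcedLift g) {δ : ℝ} (hδ : δ ≤ 1 / 4) (h : CircleClose F.F H.F δ) :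
    ∃ m : ℤ, ∀ x y, |H.F x y - F.F x y - m| < δ := by
  obtain ⟨m, hm⟩ := exists_int_const (Y := X × ℝ) (H.cont.sub F.cont) hδ (fun p => h p.1 p.2)
  exact ⟨m, fun x y => hm (x, y)⟩

theorem exists_rotation_multiple_between (hω : Irrational ω) {a b : ℝ} (hab : a < b) :
    ∃ (k : ℤ) (r : ℝ), (r : AddCircle (1 : ℝ)) = k • (ω : AddCircle (1 : ℝ)) ∧ a < r ∧ r < b := by
  have hd : Dense (AddSubgroup.closure {ω, (1 : ℝ)} : Set ℝ) := by
    rw [dense_addSubgroupClosure_pair_iff, div_one]; exact hω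
  obtain ⟨r, hr, h1⟩ := hd.exists_between hab
  obtain ⟨k, p, rfl⟩ := AddSubgroup.mem_closure_pair.mp hr
  refine ⟨k, _, ?_, h1.1, h1.2⟩
  rw [AddCircle.coe_add, AddCircle.coe_zsmul, AddCircle.coe_zsmul, AddCircle.coe_period, smul_zero,
    add_zero]

/-- A forced Arnold map that is not mode-locked has an almost invariant continuous curve. -/
theorem exists_almost_invariant_curve (hω : Irrational ω)
    (hg : g = fun θ => θ + (ω : AddCircle (1 : ℝ))) (hα : α ∈ Set.Ioo (0 : ℝ) 1)
    (h : C(AddCircle (1 : ℝ), ℝ)) (hml : ¬ ModeLocked g (arnoldLift g hα 0 0 h).F)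
    {δ : ℝ} (hδ : 0 < δ) :
    ∃ (k : ℤ) (r : ℝ) (u : C(AddCircle (1 : ℝ), ℝ)),
      (r : AddCircle (1 : ℝ)) = k • (ω : AddCircle (1 : ℝ)) ∧
      ∀ θ, |u (g θ) - (arnoldLift g hα k r h).F θ (u θ)| ≤ δ := by
  set F := arnoldLift g hα 0 0 h with hF
  simp only [ModeLocked, not_exists, not_and, not_forall] at hml
  obtain ⟨H, hH, ρ, ρ', hρ, hρ', hne⟩ := hml (min δ (1 / 4)) (lt_min hδ (by norm_num))
  obtain ⟨m, hm⟩ := F.exists_int_close H (min_le_right _ _) hH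
  have hm' : ∀ x y, |H.F x y - F.F x y - m| < δ := fun x y => (hm x y).trans_le (min_le_left _ _)
  let hp := h + ContinuousMap.const _ δ
  let hd := h + ContinuousMap.const _ (-δ)
  have main : ∃ (k : ℤ) (r : ℝ), (r : AddCircle (1 : ℝ)) = k • (ω : AddCircle (1 : ℝ)) ∧
      (∀ x, ∃ n, 1 < fiberIter g (arnoldLift g hα k r hp).F n x 0) ∧
      (∀ x, ∃ n, fiberIter g (arnoldLift g hα k r hd).F n x 0 < -1) := by
    rcases lt_trichotomy ρ (ρ' - m) with hlt | heq | hlt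
    · obtain ⟨k, r, hr, h1, h2⟩ := exists_rotation_multiple_between hω hlt
      refine ⟨k, r, hr, arnoldLift_drift_up hg hα hr hp H (m := m) (fun x y => ?_) hρ'
        (by linarith), arnoldLift_drift_down hg hα hr hd F (m := 0) (fun x y => ?_) hρ
        (by push_cast; linarith)⟩
      · rw [arnoldLift_add_const]
        have := (abs_lt.mp (hm' x y)).2
        linarith
      · rw [arnoldLift_add_const]
        push_cast; linarith
    · exact (hne m (by linarith)).elim
    · obtain ⟨k, r, hr, h1, h2⟩ := exists_rotation_multiple_between hω hlt
      refine ⟨k, r, hr, arnoldLift_drift_up hg hα hr hp F (m := 0) (fun x y => ?_) hρ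
        (by push_cast; linarith), arnoldLift_drift_down hg hα hr hd H (m := m) (fun x y => ?_) hρ'
        (by linarith)⟩
      · rw [arnoldLift_add_const]
        push_cast; linarith
      · rw [arnoldLift_add_const]
        have := (abs_lt.mp (hm' x y)).1
        linarith
  obtain ⟨k, r, hr, hup, hdown⟩ := main
  subst hg
  obtain ⟨u, hu⟩ := exists_curve_between (g := Homeomorph.addRight (ω : AddCircle (1 : ℝ)))
    (arnoldLift _ hα k r hp) (arnoldLift _ hα k r hd)
    (fun x y => by rw [arnoldLift_add_const, arnoldLift_add_const]; linarith) hup hdown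
  refine ⟨k, r, u, hr, fun θ => ?_⟩
  have h1 := hu θ
  rw [arnoldLift_add_const, arnoldLift_add_const] at h1
  rw [abs_le]
  constructor
  · have := h1.1
    simp only [Homeomorph.coe_addRight, arnoldLift_apply] at this ⊢
    linarith
  · have := h1.2
    simp only [Homeomorph.coe_addRight, arnoldLift_apply] at this ⊢
    linarith

theorem le_of_tendsto_div_of_forall_le {x : ℕ → ℝ} {ρ c D : ℝ}
    (hx : Tendsto (fun n : ℕ => x n / n) atTop (𝓝 ρ)) (h : ∀ n : ℕ, n * c - D ≤ x n) : c ≤ ρ := by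
  have h1 : Tendsto (fun n : ℕ => c - D / n) atTop (𝓝 c) := by
    simpa using tendsto_const_nhds.sub (tendsto_const_div_atTop_nhds_zero_nat D)
  refine le_of_tendsto_of_tendsto h1 hx ?_
  filter_upwards [eventually_gt_atTop 0] with n hn
  have hn0 : (0 : ℝ) < n := by exact_mod_cast hn
  rw [le_div_iff₀ hn0, sub_mul, div_mul_cancel₀ _ hn0.ne']
  linarith [h n]

theorem exists_pos_forall_le {X : Type*} [TopologicalSpace X] [CompactSpace X] {D : X → ℝ}
    (hD : Continuous D) (h : ∀ x, 0 < D x) : ∃ δ > 0, ∀ x, δ ≤ D x := by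
  rcases isEmpty_or_nonempty X with hX | hX
  · exact ⟨1, one_pos, fun x => (hX.false x).elim⟩
  · obtain ⟨x, hx⟩ := hD.exists_forall_le_of_hasCompactSupport (HasCompactSupport.of_compactSpace D)
    exact ⟨D x, h x, hx⟩

/-- A curve that moves strictly up and a curve that moves strictly down force mode-locking. -/
theorem modeLocked_of_curves (hg : g = fun θ => θ + (ω : AddCircle (1 : ℝ)))
    (hα : α ∈ Set.Ioo (0 : ℝ) 1) {k : ℤ} {r : ℝ}
    (hr : (r : AddCircle (1 : ℝ)) = k • (ω : AddCircle (1 : ℝ)))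
    (h u v : C(AddCircle (1 : ℝ), ℝ))
    (hu : ∀ θ, u (g θ) < (arnoldLift g hα k r h).F θ (u θ))
    (hv : ∀ θ, (arnoldLift g hα k r h).F θ (v θ) < v (g θ)) :
    ModeLocked g (arnoldLift g hα 0 0 h).F := by
  set G := arnoldLift g hα k r h with hG
  set F := arnoldLift g hα 0 0 h with hF
  have hgc : Continuous g := by rw [hg]; fun_prop
  have hcu : ∀ w : C(AddCircle (1 : ℝ), ℝ), Continuous fun θ => G.F θ (w θ) := fun w =>
    G.cont.comp (continuous_id.prodMk w.continuous)
  obtain ⟨δ₁, hδ₁, hu'⟩ := exists_pos_forall_le (D := fun θ => G.F θ (u θ) - u (g θ))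
    ((hcu u).sub (u.continuous.comp hgc)) (fun θ => sub_pos.mpr (hu θ))
  obtain ⟨δ₂, hδ₂, hv'⟩ := exists_pos_forall_le (D := fun θ => v (g θ) - G.F θ (v θ))
    ((v.continuous.comp hgc).sub (hcu v)) (fun θ => sub_pos.mpr (hv θ))
  have hz : ∀ n : ℕ, ((n * r : ℝ) : AddCircle (1 : ℝ)) = k • (g^[n] 0) := by
    intro n
    have := coe_add_nsmul_of_coe (θ := 0) (z := 0) hr (by simp) n
    rw [zero_add] at this
    rw [this, hg, rotation_iterate]
  have hstep : ∀ (n : ℕ) (w : ℝ), F.F (g^[n] 0) (w + n * r) = G.F (g^[n] 0) w + n * r + r :=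
    fun n w => arnoldLift_add hα r h w (hz n)
  have main : ∀ (H : ForcedLift g) (m : ℤ),
      (∀ x y, |H.F x y - F.F x y - m| < min (min δ₁ δ₂) (1 / 4)) →
      ∀ ρ, HasRotNum g H.F ρ → ρ = r + m := by
    intro H m hH ρ hρ
    have hH1 : ∀ x y, |H.F x y - F.F x y - m| < δ₁ := fun x y =>
      (hH x y).trans_le ((min_le_left _ _).trans (min_le_left _ _))
    have hH2 : ∀ x y, |H.F x y - F.F x y - m| < δ₂ := fun x y =>
      (hH x y).trans_le ((min_le_left _ _).trans (min_le_right _ _))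
    have h_int : ∀ (n : ℕ) (y : ℝ), H.F (g^[n] 0) (y + n * m) = H.F (g^[n] 0) y + n * m := by
      intro n y
      have := H.add_int (g^[n] 0) y (n * m)
      push_cast at this
      exact this
    apply le_antisymm
    · have hit : ∀ n : ℕ, fiberIter g H.F n 0 (v 0) ≤ v (g^[n] 0) + n * r + n * m := by
        intro n
        induction n with
        | zero => simp [fiberIter]
        | succ n ih =>
          have h1 := (H.mono (g^[n] 0)).monotone ih
          rw [h_int] at h1
          have h2 := (abs_lt.mp (hH2 (g^[n] 0) (v (g^[n] 0) + n * r))).2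
          rw [hstep] at h2
          have h3 := hv' (g^[n] 0)
          rw [fiberIter, Function.iterate_succ_apply']
          push_cast
          linarith
      have h5 := (hρ 0 (v 0)).neg
      refine neg_le_neg_iff.mp (le_of_tendsto_div_of_forall_le (D := ‖v‖ + ‖v‖)
        (x := fun n => -(fiberIter g H.F n 0 (v 0) - v 0)) ?_ fun n => ?_)
      · simpa only [neg_div] using h5
      · have h6 := hit n
        have h7 := (abs_le.mp (v.norm_coe_le_norm (g^[n] 0))).2
        have h8 := (abs_le.mp (v.norm_coe_le_norm 0)).1
        linarith
    · have hit : ∀ n : ℕ, u (g^[n] 0) + n * r + n * m ≤ fiberIter g H.F n 0 (u 0) := by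
        intro n
        induction n with
        | zero => simp [fiberIter]
        | succ n ih =>
          have h1 := (H.mono (g^[n] 0)).monotone ih
          rw [h_int] at h1
          have h2 := (abs_lt.mp (hH1 (g^[n] 0) (u (g^[n] 0) + n * r))).1
          rw [hstep] at h2
          have h3 := hu' (g^[n] 0)
          rw [fiberIter, Function.iterate_succ_apply']
          push_cast
          linarith
      refine le_of_tendsto_div_of_forall_le (D := ‖u‖ + ‖u‖) (hρ 0 (u 0)) fun n => ?_
      have h6 := hit n
      have h7 := (abs_le.mp (u.norm_coe_le_norm (g^[n] 0))).1
      have h8 := (abs_le.mp (u.norm_coe_le_norm 0)).2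
      linarith
  have hδ : 0 < min (min δ₁ δ₂) (1 / 4) := lt_min (lt_min hδ₁ hδ₂) (by norm_num)
  refine ⟨_, hδ, fun H hH ρ ρ' hρ hρ' => ?_⟩
  obtain ⟨m, hm⟩ := F.exists_int_close H (min_le_right _ _) hH
  refine ⟨m, ?_⟩
  rw [main H m hm ρ' hρ', main F 0 (fun x y => by simpa using hδ) ρ hρ]
  push_cast; ring

end

section

variable {g : AddCircle (1 : ℝ) → AddCircle (1 : ℝ)} {α : ℝ} {ω : ℝ}

theorem abs_sin_add_sub_le (x : ℝ) {e : ℝ} (he : |e| ≤ 1) :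
    |Real.sin (x + e) - Real.sin x - e * Real.cos x| ≤ e ^ 2 := by
  have h1 := Real.one_sub_sq_div_two_le_cos (x := e)
  have h2 := Real.cos_le_one e
  have h3 : |Real.sin e - e| ≤ e ^ 2 / 2 := by
    have hb := Real.sin_bound he
    have h0 := abs_nonneg e
    have h4 : |e| ^ 3 ≤ |e| ^ 2 := pow_le_pow_of_le_one h0 he (by norm_num)
    have h5 : |e| ^ 5 ≤ |e| ^ 2 := pow_le_pow_of_le_one h0 he (by norm_num)
    have h6 : |e ^ 3| = |e| ^ 3 := abs_pow e 3
    rw [← sq_abs e]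
    calc |Real.sin e - e| = |(Real.sin e - (e - e ^ 3 / 6)) - e ^ 3 / 6| := by congr 1; ring
      _ ≤ |Real.sin e - (e - e ^ 3 / 6)| + |e ^ 3 / 6| := abs_sub _ _
      _ ≤ |e| ^ 2 / 2 := by
        rw [abs_div, h6, abs_of_pos (by norm_num : (0 : ℝ) < 6)]
        have := sq_nonneg |e|
        linarith
  have h4 : |Real.sin x * (Real.cos e - 1)| ≤ e ^ 2 / 2 := by
    rw [abs_mul]
    calc _ ≤ 1 * |Real.cos e - 1| := by gcongr; exact Real.abs_sin_le_one x
      _ ≤ e ^ 2 / 2 := by rw [one_mul, abs_le]; constructor <;> linarith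
  have h5 : |Real.cos x * (Real.sin e - e)| ≤ e ^ 2 / 2 := by
    rw [abs_mul]
    calc _ ≤ 1 * |Real.sin e - e| := by gcongr; exact Real.abs_cos_le_one x
      _ ≤ e ^ 2 / 2 := by rw [one_mul]; exact h3
  rw [Real.sin_add]
  calc _ = |Real.sin x * (Real.cos e - 1) + Real.cos x * (Real.sin e - e)| := by
        congr 1; ring
    _ ≤ _ := (abs_add_le _ _).trans (by linarith)

/-- The fiber derivative of `arnoldLift` along the curve `v`. -/
noncomputable def arnoldDeriv (α : ℝ) (k : ℤ) (v : C(AddCircle (1 : ℝ), ℝ)) :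
    C(AddCircle (1 : ℝ), ℝ) where
  toFun θ := 1 + α * circCos (k • θ + (v θ : AddCircle (1 : ℝ)))
  continuous_toFun := by
    have : Continuous fun θ => (v θ : AddCircle (1 : ℝ)) :=
      (AddCircle.continuous_mk' 1).comp v.continuous
    fun_prop

theorem arnoldDeriv_apply (k : ℤ) (v : C(AddCircle (1 : ℝ), ℝ)) (θ : AddCircle (1 : ℝ)) :
    arnoldDeriv α k v θ = 1 + α * circCos (k • θ + (v θ : AddCircle (1 : ℝ))) := rfl

theorem arnoldDeriv_pos (hα : α ∈ Set.Ioo (0 : ℝ) 1) (k : ℤ) (v : C(AddCircle (1 : ℝ), ℝ))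
    (θ : AddCircle (1 : ℝ)) : 0 < arnoldDeriv α k v θ := by
  rw [arnoldDeriv_apply]
  have h1 := (abs_le.mp (abs_circCos_le_one (k • θ + (v θ : AddCircle (1 : ℝ))))).1
  have h2 := mul_le_mul_of_nonneg_left h1 hα.1.le
  linarith [hα.2]

theorem abs_arnoldLift_add_sub_le (hα : α ∈ Set.Ioo (0 : ℝ) 1) (k : ℤ) (r : ℝ)
    (h v : C(AddCircle (1 : ℝ), ℝ)) (θ : AddCircle (1 : ℝ)) {d : ℝ} (hd : 7 * |d| ≤ 1) :
    |(arnoldLift g hα k r h).F θ (v θ + d) - (arnoldLift g hα k r h).F θ (v θ)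
      - arnoldDeriv α k v θ * d| ≤ 7 * d ^ 2 := by
  rw [arnoldLift_apply, arnoldLift_apply, arnoldDeriv_apply]
  obtain ⟨z, hz⟩ := exists_coe_eq (k • θ)
  rw [← hz, ← AddCircle.coe_add, ← AddCircle.coe_add, circSin_coe, circSin_coe, circCos_coe]
  have hpi := Real.two_pi_pos
  have hpi3 : 2 * Real.pi < 7 := by linarith [Real.pi_lt_d2]
  have he : |2 * Real.pi * d| ≤ 1 := by
    rw [abs_mul, abs_of_pos hpi]
    exact (mul_le_mul_of_nonneg_right hpi3.le (abs_nonneg d)).trans hd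
  have hs := abs_sin_add_sub_le (2 * Real.pi * (z + v θ)) he
  have h0 := hα.1
  have h1 := hα.2
  rw [show 2 * Real.pi * (z + (v θ + d)) = 2 * Real.pi * (z + v θ) + 2 * Real.pi * d by ring]
  calc _ = |α / (2 * Real.pi) * (Real.sin (2 * Real.pi * (z + v θ) + 2 * Real.pi * d)
            - Real.sin (2 * Real.pi * (z + v θ))
            - 2 * Real.pi * d * Real.cos (2 * Real.pi * (z + v θ)))| := by
        congr 1; field_simp; ring
    _ = α / (2 * Real.pi) * _ := by rw [abs_mul, abs_of_pos (by positivity)]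
    _ ≤ α / (2 * Real.pi) * (2 * Real.pi * d) ^ 2 := by gcongr
    _ = α * (2 * Real.pi) * d ^ 2 := by field_simp
    _ ≤ 7 * d ^ 2 := by
        gcongr
        nlinarith

/-- An invariant curve along which a cocycle of the fiber derivative is strictly expanded
forces mode-locking. -/
theorem modeLocked_of_strict_subsolution (hg : g = fun θ => θ + (ω : AddCircle (1 : ℝ)))
    (hα : α ∈ Set.Ioo (0 : ℝ) 1) {k : ℤ} {r : ℝ}
    (hr : (r : AddCircle (1 : ℝ)) = k • (ω : AddCircle (1 : ℝ)))
    (h v E : C(AddCircle (1 : ℝ), ℝ))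
    (hv : ∀ θ, v (g θ) = (arnoldLift g hα k r h).F θ (v θ))
    (hE : ∀ θ, arnoldDeriv α k v θ * E θ < E (g θ)) :
    ModeLocked g (arnoldLift g hα 0 0 h).F := by
  have hgc : Continuous g := by rw [hg]; fun_prop
  obtain ⟨γ, hγ, hγE⟩ := exists_pos_forall_le
    (D := fun θ => E (g θ) - arnoldDeriv α k v θ * E θ) (by fun_prop)
    (fun θ => sub_pos.mpr (hE θ))
  set M := ‖E‖ + 1 with hM
  have hM1 : 1 ≤ M := by have := norm_nonneg E; linarith
  have hEM : ∀ θ, |E θ| ≤ M := fun θ => by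
    have := E.norm_coe_le_norm θ
    rw [Real.norm_eq_abs] at this
    linarith
  obtain ⟨δ, hδ, hδ1⟩ : ∃ δ > 0, δ < min (γ / (7 * M ^ 2)) (1 / (7 * M)) :=
    exists_between (lt_min (by positivity) (by positivity))
  have hδγ : 7 * δ ^ 2 * M ^ 2 < δ * γ := by
    have := (lt_div_iff₀ (by positivity)).mp (hδ1.trans_le (min_le_left _ _))
    nlinarith
  have hδM : 7 * (δ * M) ≤ 1 := by
    have := (lt_div_iff₀ (by positivity)).mp (hδ1.trans_le (min_le_right _ _))
    linarith
  have key : ∀ (s : ℝ), |s| = δ → ∀ θ, |(arnoldLift g hα k r h).F θ (v θ + s * E θ)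
      - v (g θ) - s * (arnoldDeriv α k v θ * E θ)| < δ * γ := by
    intro s hs θ
    have h1 : |s * E θ| ≤ δ * M := by rw [abs_mul, hs]; gcongr; exact hEM θ
    have h2 := abs_arnoldLift_add_sub_le (g := g) hα k r h v θ (d := s * E θ) (by linarith)
    rw [← hv, show arnoldDeriv α k v θ * (s * E θ) = s * (arnoldDeriv α k v θ * E θ) by ring] at h2
    refine h2.trans_lt (lt_of_le_of_lt ?_ hδγ)
    rw [← sq_abs, mul_assoc, ← mul_pow]
    gcongr
  refine modeLocked_of_curves hg hα hr h (v + (-δ) • E) (v + δ • E) (fun θ => ?_) (fun θ => ?_)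
  · have h1 := (abs_lt.mp (key (-δ) (by rw [abs_neg, abs_of_pos hδ]) θ)).1
    have h2 := mul_le_mul_of_nonneg_left (hγE θ) hδ.le
    simp only [ContinuousMap.add_apply, ContinuousMap.smul_apply, smul_eq_mul]
    linarith
  · have h1 := (abs_lt.mp (key δ (abs_of_pos hδ) θ)).2
    have h2 := mul_le_mul_of_nonneg_left (hγE θ) hδ.le
    simp only [ContinuousMap.add_apply, ContinuousMap.smul_apply, smul_eq_mul]
    linarith

/-- The logarithm of the fiber derivative along the curve `v`. -/
noncomputable def arnoldLogDeriv (hα : α ∈ Set.Ioo (0 : ℝ) 1) (k : ℤ)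
    (v : C(AddCircle (1 : ℝ), ℝ)) : C(AddCircle (1 : ℝ), ℝ) where
  toFun θ := Real.log (arnoldDeriv α k v θ)
  continuous_toFun :=
    (arnoldDeriv α k v).continuous.log fun θ => (arnoldDeriv_pos hα k v θ).ne'

theorem arnoldLogDeriv_apply (hα : α ∈ Set.Ioo (0 : ℝ) 1) (k : ℤ) (v : C(AddCircle (1 : ℝ), ℝ))
    (θ : AddCircle (1 : ℝ)) : arnoldLogDeriv hα k v θ = Real.log (arnoldDeriv α k v θ) := rfl

theorem exp_arnoldLogDeriv (hα : α ∈ Set.Ioo (0 : ℝ) 1) (k : ℤ) (v : C(AddCircle (1 : ℝ), ℝ))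
    (θ : AddCircle (1 : ℝ)) : Real.exp (arnoldLogDeriv hα k v θ) = arnoldDeriv α k v θ :=
  Real.exp_log (arnoldDeriv_pos hα k v θ)

/-- A hyperbolic invariant curve forces mode-locking. -/
theorem modeLocked_of_hyperbolic_curve (hω : Irrational ω)
    (hg : g = fun θ => θ + (ω : AddCircle (1 : ℝ)))
    (hα : α ∈ Set.Ioo (0 : ℝ) 1) {k : ℤ} {r : ℝ}
    (hr : (r : AddCircle (1 : ℝ)) = k • (ω : AddCircle (1 : ℝ)))
    (h v : C(AddCircle (1 : ℝ), ℝ))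
    (hv : ∀ θ, v (g θ) = (arnoldLift g hα k r h).F θ (v θ))
    (hI : ∫ θ, arnoldLogDeriv hα k v θ ∂AddCircle.haarAddCircle ≠ 0) :
    ModeLocked g (arnoldLift g hα 0 0 h).F := by
  rcases hI.lt_or_gt with hI | hI
  · obtain ⟨l, hl⟩ := exists_lt_coboundary hω _ hI
    refine modeLocked_of_strict_subsolution hg hα hr h v
      ⟨fun θ => Real.exp (l θ), by fun_prop⟩ hv fun θ => ?_
    rw [← exp_arnoldLogDeriv hα]
    simp only [ContinuousMap.coe_mk]
    rw [← Real.exp_add, Real.exp_lt_exp, hg]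
    linarith [hl θ]
  · obtain ⟨l, hl⟩ := exists_lt_coboundary hω (-arnoldLogDeriv hα k v) (by
      simpa [integral_neg] using hI)
    refine modeLocked_of_strict_subsolution hg hα hr h v
      ⟨fun θ => -Real.exp (-l θ), by fun_prop⟩ hv fun θ => ?_
    rw [← exp_arnoldLogDeriv hα]
    simp only [ContinuousMap.coe_mk]
    rw [mul_neg, ← Real.exp_add, neg_lt_neg_iff, Real.exp_lt_exp, hg]
    have := hl θ
    rw [ContinuousMap.neg_apply] at this
    linarith

theorem cos_add_mul_sin_lt_of_sin_pos {y s : ℝ} (hs : 0 < s) (hs1 : s ≤ 1)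
    (hy : 0 < Real.sin y) : Real.cos (y + s * Real.sin y) < Real.cos y := by
  set S := Real.sin y with hS
  have hS1 : S ≤ 1 := Real.sin_le_one y
  have hd0 : 0 < s * S / 2 := by positivity
  have hd1 : s * S / 2 ≤ S / 2 := by nlinarith
  have ht0 : 0 < Real.sin (s * S / 2) :=
    Real.sin_pos_of_pos_of_lt_pi hd0 (by linarith [Real.pi_gt_three])
  have ht1 : Real.sin (s * S / 2) < S / 2 := (Real.sin_lt hd0).trans_le hd1
  have hc : 7 / 8 ≤ Real.cos (s * S / 2) := by
    have := Real.one_sub_sq_div_two_le_cos (x := s * S / 2)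
    nlinarith
  have h1 : Real.cos y - Real.cos (y + s * S)
      = 2 * Real.sin (s * S / 2) * (S * Real.cos (s * S / 2)
        + Real.cos y * Real.sin (s * S / 2)) := by
    rw [Real.cos_sub_cos, hS, ← Real.sin_add,
      show (y + (y + s * Real.sin y)) / 2 = y + s * Real.sin y / 2 by ring,
      show (y - (y + s * Real.sin y)) / 2 = -(s * Real.sin y / 2) by ring, Real.sin_neg]
    ring
  have h2 := Real.neg_one_le_cos y
  have h3 : 0 < S * Real.cos (s * S / 2) + Real.cos y * Real.sin (s * S / 2) := by
    nlinarith
  have := mul_pos (mul_pos two_pos ht0) h3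
  linarith

theorem cos_add_mul_sin_lt {y s : ℝ} (hs : 0 < s) (hs1 : s ≤ 1) (hy : Real.sin y ≠ 0) :
    Real.cos (y + s * Real.sin y) < Real.cos y := by
  rcases hy.lt_or_gt with hy | hy
  · have := cos_add_mul_sin_lt_of_sin_pos (y := -y) hs hs1 (by rw [Real.sin_neg]; linarith)
    rwa [Real.sin_neg, show -y + s * -Real.sin y = -(y + s * Real.sin y) by ring, Real.cos_neg,
      Real.cos_neg] at this
  · exact cos_add_mul_sin_lt_of_sin_pos hs hs1 hy

theorem eq_zero_of_integral_eq_zero (a : C(AddCircle (1 : ℝ), ℝ)) (ha : ∀ θ, 0 ≤ a θ)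
    (hI : ∫ θ, a θ ∂AddCircle.haarAddCircle = 0) (θ : AddCircle (1 : ℝ)) : a θ = 0 := by
  rw [integral_eq_zero_iff_of_nonneg ha
    (a.continuous.integrable_of_hasCompactSupport (HasCompactSupport.of_compactSpace _))] at hI
  exact congr_fun ((a.continuous.ae_eq_iff_eq _ continuous_zero).mp hI) θ

theorem integral_ne_zero_of_forall_ne_zero (a : C(AddCircle (1 : ℝ), ℝ)) (ha : ∀ θ, a θ ≠ 0) :
    ∫ θ, a θ ∂AddCircle.haarAddCircle ≠ 0 := by
  intro hI
  by_cases h : ∀ θ, 0 ≤ a θ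
  · exact ha 0 (eq_zero_of_integral_eq_zero a h hI 0)
  push Not at h
  obtain ⟨x, hx⟩ := h
  by_cases h2 : ∀ θ, a θ ≤ 0
  · have := eq_zero_of_integral_eq_zero (-a) (fun θ => by simpa using h2 θ)
      (by simpa [integral_neg] using hI) 0
    exact ha 0 (by simpa using this)
  push Not at h2
  obtain ⟨y, hy⟩ := h2
  obtain ⟨z, hz⟩ := mem_range_of_exists_le_of_exists_ge a.continuous ⟨x, hx.le⟩ ⟨y, hy.le⟩
  exact ha z hz

/-- Every curve can be perturbed so that the fiber derivative along it has nonzero mean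
logarithm. -/
theorem exists_arnoldLogDeriv_integral_ne_zero (hα : α ∈ Set.Ioo (0 : ℝ) 1) (k : ℤ)
    (u : C(AddCircle (1 : ℝ), ℝ)) {η : ℝ} (hη : 0 < η) :
    ∃ v : C(AddCircle (1 : ℝ), ℝ), (∀ θ, |v θ - u θ| ≤ η) ∧
      ∫ θ, arnoldLogDeriv hα k v θ ∂AddCircle.haarAddCircle ≠ 0 := by
  by_cases hu : ∫ θ, arnoldLogDeriv hα k u θ ∂AddCircle.haarAddCircle = 0
  swap
  · exact ⟨u, fun θ => by simpa using hη.le, hu⟩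
  obtain ⟨t, ht0, ht⟩ : ∃ t > 0, t < min η (1 / 7) := exists_between (lt_min hη (by norm_num))
  have htη := ht.trans_le (min_le_left _ _)
  have ht7 := ht.trans_le (min_le_right _ _)
  have huc : Continuous fun θ => (u θ : AddCircle (1 : ℝ)) :=
    (AddCircle.continuous_mk' 1).comp u.continuous
  refine ⟨⟨fun θ => u θ + t * circSin (k • θ + (u θ : AddCircle (1 : ℝ))), by fun_prop⟩,
    fun θ => ?_, fun hv => ?_⟩
  · simp only [ContinuousMap.coe_mk, add_sub_cancel_left]
    rw [abs_mul, abs_of_pos ht0]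
    exact (mul_le_of_le_one_right ht0.le (abs_circSin_le_one _)).trans htη.le
  set v : C(AddCircle (1 : ℝ), ℝ) :=
    ⟨fun θ => u θ + t * circSin (k • θ + (u θ : AddCircle (1 : ℝ))), by fun_prop⟩
  have hlt : ∀ θ, circSin (k • θ + (u θ : AddCircle (1 : ℝ))) ≠ 0 →
      arnoldLogDeriv hα k v θ < arnoldLogDeriv hα k u θ := by
    intro θ hθ
    rw [arnoldLogDeriv_apply, arnoldLogDeriv_apply]
    refine Real.log_lt_log (arnoldDeriv_pos hα k v θ) ?_
    have hvθ : v θ = u θ + t * circSin (k • θ + (u θ : AddCircle (1 : ℝ))) := rfl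
    rw [arnoldDeriv_apply, arnoldDeriv_apply, hvθ]
    obtain ⟨z, hz⟩ := exists_coe_eq (k • θ)
    rw [← hz, ← AddCircle.coe_add, circSin_coe] at hθ
    rw [← hz, ← AddCircle.coe_add, ← AddCircle.coe_add, circSin_coe, circCos_coe, circCos_coe]
    have := cos_add_mul_sin_lt (s := 2 * Real.pi * t) (by positivity)
      (by nlinarith [Real.pi_lt_d2]) hθ
    rw [show 2 * Real.pi * (z + (u θ + t * Real.sin (2 * Real.pi * (z + u θ))))
      = 2 * Real.pi * (z + u θ) + 2 * Real.pi * t * Real.sin (2 * Real.pi * (z + u θ)) by ring]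
    have := mul_lt_mul_of_pos_left this hα.1
    linarith
  have heq : ∀ θ, circSin (k • θ + (u θ : AddCircle (1 : ℝ))) = 0 → v θ = u θ := by
    intro θ hθ
    change u θ + t * _ = u θ
    rw [hθ, mul_zero, add_zero]
  have hle : ∀ θ, 0 ≤ (arnoldLogDeriv hα k u - arnoldLogDeriv hα k v) θ := by
    intro θ
    rw [ContinuousMap.sub_apply, sub_nonneg]
    by_cases hθ : circSin (k • θ + (u θ : AddCircle (1 : ℝ))) = 0
    · rw [arnoldLogDeriv_apply, arnoldLogDeriv_apply, arnoldDeriv_apply, arnoldDeriv_apply,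
        heq θ hθ]
    · exact (hlt θ hθ).le
  have h_int : ∀ a : C(AddCircle (1 : ℝ), ℝ), Integrable a AddCircle.haarAddCircle := fun a =>
    a.continuous.integrable_of_hasCompactSupport (HasCompactSupport.of_compactSpace _)
  have hzero := eq_zero_of_integral_eq_zero _ hle (by
    simp only [ContinuousMap.sub_apply]
    rw [integral_sub (h_int _) (h_int _), hu, hv, sub_zero])
  refine integral_ne_zero_of_forall_ne_zero (arnoldLogDeriv hα k u) (fun θ h0 => ?_) hu
  have hsin : circSin (k • θ + (u θ : AddCircle (1 : ℝ))) = 0 := by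
    by_contra hne
    have h1 := hlt θ hne
    have h2 := hzero θ
    rw [ContinuousMap.sub_apply] at h2
    linarith
  have hone := exp_arnoldLogDeriv hα k u θ
  rw [h0, Real.exp_zero, arnoldDeriv_apply] at hone
  obtain ⟨z, hz⟩ := exists_coe_eq (k • θ)
  rw [← hz, ← AddCircle.coe_add, circSin_coe] at hsin
  rw [← hz, ← AddCircle.coe_add, circCos_coe] at hone
  have hcos : α * Real.cos (2 * Real.pi * (z + u θ)) = 0 := by linarith
  have hc := (mul_eq_zero.mp hcos).resolve_left hα.1.ne'
  have := Real.sin_sq_add_cos_sq (2 * Real.pi * (z + u θ))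
  rw [hsin, hc] at this
  norm_num at this

/-- Mode-locked forcings are dense. -/
theorem exists_close_modeLocked (hω : Irrational ω)
    (hg : g = fun θ => θ + (ω : AddCircle (1 : ℝ))) (hα : α ∈ Set.Ioo (0 : ℝ) 1)
    (h : C(AddCircle (1 : ℝ), ℝ)) {ε : ℝ} (hε : 0 < ε) :
    ∃ h' : C(AddCircle (1 : ℝ), ℝ), (∀ θ, |h' θ - h θ| ≤ ε) ∧
      ModeLocked g (arnoldLift g hα 0 0 h').F := by
  by_cases hml : ModeLocked g (arnoldLift g hα 0 0 h).F
  · exact ⟨h, fun θ => by simpa using hε.le, hml⟩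
  obtain ⟨k, r, u, hr, hu⟩ := exists_almost_invariant_curve hω hg hα h hml
    (δ := ε / 4) (by positivity)
  obtain ⟨v, hvu, hI⟩ := exists_arnoldLogDeriv_integral_ne_zero hα k u (η := ε / 4) (by positivity)
  have hgc : Continuous g := by rw [hg]; fun_prop
  refine ⟨⟨fun θ => h θ + (v (g θ) - (arnoldLift g hα k r h).F θ (v θ)), ?_⟩, fun θ => ?_,
    modeLocked_of_hyperbolic_curve hω hg hα hr _ v (fun θ => ?_) hI⟩
  · have := (arnoldLift g hα k r h).cont.comp (continuous_id.prodMk v.continuous)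
    exact h.continuous.add ((v.continuous.comp hgc).sub this)
  · simp only [ContinuousMap.coe_mk, add_sub_cancel_left]
    have h1 := abs_le.mp (abs_scaled_circSin_sub_le hα (k • θ) (v θ) (u θ))
    have h2 := hα.2
    have h3 := abs_le.mp (hu θ)
    have h4 := abs_le.mp (hvu θ)
    have h5 := abs_le.mp (hvu (g θ))
    have h6 : α * |v θ - u θ| ≤ ε / 4 := by nlinarith [hvu θ, abs_nonneg (v θ - u θ)]
    rw [arnoldLift_apply] at h3 ⊢
    rw [abs_le]
    constructor <;> linarith
  · simp only [arnoldLift_apply, ContinuousMap.coe_mk]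
    ring

end

section

variable {ω : ℝ}

/-- Mode-locking is a `C⁰`-open condition. -/
theorem ForcedLift.modeLocked_of_close {X : Type*} [TopologicalSpace X] {g : X → X}
    (F : ForcedLift g) {ρ : ℝ} (hρ : HasRotNum g F.F ρ) (hml : ModeLocked g F.F) :
    ∃ δ > 0, ∀ H : ForcedLift g, (∀ x y, |H.F x y - F.F x y| < δ) → ModeLocked g H.F := by
  obtain ⟨δ, hδ, hF⟩ := hml
  refine ⟨δ / 2, by positivity, fun H hH => ⟨δ / 2, by positivity, fun K hK σ σ' hσ hσ' => ?_⟩⟩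
  obtain ⟨m, hm⟩ := hF H (fun x y => ⟨0, by
    have := hH x y
    rw [Int.cast_zero, sub_zero]; linarith⟩) ρ σ hρ hσ
  obtain ⟨n, hn⟩ := hF K (fun x y => by
    obtain ⟨i, hi⟩ := hK x y
    refine ⟨i, ?_⟩
    have h1 := abs_lt.mp hi
    have h2 := abs_lt.mp (hH x y)
    rw [abs_lt]; constructor <;> linarith) ρ σ' hρ hσ'
  exact ⟨n - m, by push_cast; linarith⟩

/-- The forced Arnold circle map is mode-locked at the parameters `p = (τ, α)`. -/
def ArnoldLocked (ω β : ℝ) (q : C(AddCircle (1 : ℝ), ℝ)) (p : ℝ × ℝ) : Prop :=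
  p.2 ∈ Set.Ioo (0 : ℝ) 1 ∧
    ModeLocked (fun θ : AddCircle (1 : ℝ) => θ + ((ω : ℝ) : AddCircle (1 : ℝ)))
      (fun θ y => y + p.1 + p.2 / (2 * Real.pi) * Real.sin (2 * Real.pi * y) + β * q θ)

theorem arnoldLift_eq {g : AddCircle (1 : ℝ) → AddCircle (1 : ℝ)} {α : ℝ}
    (hα : α ∈ Set.Ioo (0 : ℝ) 1) (τ β : ℝ) (q : C(AddCircle (1 : ℝ), ℝ)) :
    (arnoldLift g hα 0 0 (ContinuousMap.const _ τ + β • q)).F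
      = fun θ y => y + τ + α / (2 * Real.pi) * Real.sin (2 * Real.pi * y) + β * q θ := by
  funext θ y
  simp only [arnoldLift_apply, zero_smul, zero_add, circSin_coe, ContinuousMap.add_apply,
    ContinuousMap.const_apply, ContinuousMap.smul_apply, smul_eq_mul]
  ring

theorem ArnoldLocked.exists_ball (hω : Irrational ω) {β : ℝ} {q : C(AddCircle (1 : ℝ), ℝ)}
    {p : ℝ × ℝ} (h : ArnoldLocked ω β q p) :
    ∃ δ > 0, ∀ (q' : C(AddCircle (1 : ℝ), ℝ)) (p' : ℝ × ℝ), p'.2 ∈ Set.Ioo (0 : ℝ) 1 →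
      |p'.1 - p.1| < δ → |p'.2 - p.2| < δ → (∀ θ, |β * q' θ - β * q θ| < δ) →
      ArnoldLocked ω β q' p' := by
  obtain ⟨hα, hml⟩ := h
  set g := fun θ : AddCircle (1 : ℝ) => θ + ((ω : ℝ) : AddCircle (1 : ℝ)) with hg
  rw [← arnoldLift_eq hα] at hml
  obtain ⟨ρ, hρ⟩ := ForcedLift.exists_hasRotNum hω hg
    (arnoldLift g hα 0 0 (ContinuousMap.const _ p.1 + β • q))
  obtain ⟨δ, hδ, hF⟩ := ForcedLift.modeLocked_of_close _ hρ hml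
  refine ⟨δ / 3, by positivity, fun q' p' hα' h1 h2 h3 => ⟨hα', ?_⟩⟩
  rw [← arnoldLift_eq hα']
  refine hF _ fun θ y => ?_
  rw [arnoldLift_eq hα, arnoldLift_eq hα']
  have h4 := h3 θ
  have h5 : |(p'.2 - p.2) / (2 * Real.pi) * Real.sin (2 * Real.pi * y)| ≤ |p'.2 - p.2| := by
    rw [abs_mul, abs_div, abs_of_pos Real.two_pi_pos]
    refine (mul_le_of_le_one_right (by positivity) (Real.abs_sin_le_one _)).trans ?_
    exact div_le_self (abs_nonneg _) (by linarith [Real.pi_gt_three])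
  calc _ = |(p'.1 - p.1) + (p'.2 - p.2) / (2 * Real.pi) * Real.sin (2 * Real.pi * y)
        + (β * q' θ - β * q θ)| := by congr 1; ring
    _ ≤ |p'.1 - p.1| + |(p'.2 - p.2) / (2 * Real.pi) * Real.sin (2 * Real.pi * y)|
        + |β * q' θ - β * q θ| := abs_add_three _ _ _
    _ < δ := by linarith

theorem isOpen_arnoldLocked (hω : Irrational ω) (β : ℝ) (q : C(AddCircle (1 : ℝ), ℝ)) :
    IsOpen {p | ArnoldLocked ω β q p} := by
  rw [Metric.isOpen_iff]
  intro p hp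
  obtain ⟨δ, hδ, h⟩ := ArnoldLocked.exists_ball hω hp
  obtain ⟨e, he, hb⟩ := Metric.isOpen_iff.mp isOpen_Ioo p.2 hp.1
  refine ⟨min δ e, lt_min hδ he, fun p' hp' => ?_⟩
  rw [Metric.mem_ball, Prod.dist_eq, max_lt_iff, Real.dist_eq, Real.dist_eq] at hp'
  refine h q p' (hb ?_) (hp'.1.trans_le (min_le_left _ _)) (hp'.2.trans_le (min_le_left _ _))
    fun θ => by simpa using hδ
  rw [Metric.mem_ball, Real.dist_eq]
  exact hp'.2.trans_le (min_le_right _ _)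

theorem isOpen_setOf_arnoldLocked_forcing (hω : Irrational ω) (β : ℝ) (p : ℝ × ℝ) :
    IsOpen {q | ArnoldLocked ω β q p} := by
  rw [Metric.isOpen_iff]
  intro q hq
  obtain ⟨δ, hδ, h⟩ := ArnoldLocked.exists_ball hω hq
  refine ⟨δ / (|β| + 1), by positivity, fun q' hq' => ?_⟩
  refine h q' p hq.1 (by simpa using hδ) (by simpa using hδ) fun θ => ?_
  rw [Metric.mem_ball, lt_div_iff₀ (by positivity)] at hq'
  have h1 := ContinuousMap.dist_apply_le_dist (f := q') (g := q) θ
  rw [Real.dist_eq] at h1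
  rw [← mul_sub, abs_mul]
  calc |β| * |q' θ - q θ| ≤ |β| * dist q' q := by gcongr
    _ ≤ dist q' q * (|β| + 1) := by nlinarith [dist_nonneg (x := q') (y := q)]
    _ < δ := hq'

theorem dense_setOf_arnoldLocked_forcing (hω : Irrational ω) {β : ℝ} (hβ : β ≠ 0) {p : ℝ × ℝ}
    (hp : p.2 ∈ Set.Ioo (0 : ℝ) 1) : Dense {q | ArnoldLocked ω β q p} := by
  rw [Metric.dense_iff]
  intro q ε hε
  obtain ⟨h', hh', hml⟩ := exists_close_modeLocked hω rfl hp
    (ContinuousMap.const _ p.1 + β • q) (ε := |β| * (ε / 2)) (by positivity)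
  refine ⟨β⁻¹ • (h' - ContinuousMap.const _ p.1), ?_, hp, ?_⟩
  · rw [Metric.mem_ball]
    refine ((ContinuousMap.dist_le (by positivity)).mpr fun θ => ?_).trans_lt (half_lt_self hε)
    have h1 := hh' θ
    simp only [ContinuousMap.add_apply, ContinuousMap.const_apply, ContinuousMap.smul_apply,
      smul_eq_mul, ContinuousMap.sub_apply] at h1 ⊢
    rw [Real.dist_eq]
    refine le_of_mul_le_mul_left ?_ (abs_pos.mpr hβ)
    rw [← abs_mul]
    refine le_trans (le_of_eq ?_) h1
    congr 1
    field_simp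
    ring
  · rw [← arnoldLift_eq hp, smul_smul, mul_inv_cancel₀ hβ, one_smul, add_sub_cancel]
    exact hml

/-- for every irrational `ω` and nonzero `β`, there is a residual
set of forcing functions `q ∈ C⁰(𝕋,ℝ)` for which the mode-locking region of the
quasi-periodically forced Arnold circle map family is open and dense in
`ℝ × (0,1)`. -/
theorem arnold_mode_locking_generic_forcing
    (ω : ℝ) (hω : Irrational ω) (β : ℝ) (hβ : β ≠ 0) :
    ∃ U : Set C(AddCircle (1 : ℝ), ℝ),
      (∃ V : ℕ → Set C(AddCircle (1 : ℝ), ℝ),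
        (∀ n, IsOpen (V n) ∧ Dense (V n)) ∧ (⋂ n, V n) ⊆ U) ∧
      ∀ q ∈ U,
        IsOpen {p : ℝ × ℝ | p.2 ∈ Set.Ioo (0 : ℝ) 1 ∧
          ModeLocked (fun θ : AddCircle (1 : ℝ) => θ + ((ω : ℝ) : AddCircle (1 : ℝ)))
            (fun θ y => y + p.1 + p.2 / (2 * Real.pi) * Real.sin (2 * Real.pi * y)
              + β * q θ)} ∧
        (Set.univ ×ˢ Set.Ioo (0 : ℝ) 1) ⊆
          closure {p : ℝ × ℝ | p.2 ∈ Set.Ioo (0 : ℝ) 1 ∧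
            ModeLocked (fun θ : AddCircle (1 : ℝ) => θ + ((ω : ℝ) : AddCircle (1 : ℝ)))
              (fun θ y => y + p.1 + p.2 / (2 * Real.pi) * Real.sin (2 * Real.pi * y)
                + β * q θ)} := by
  classical
  set D : ℕ → ℝ × ℝ := TopologicalSpace.denseSeq (ℝ × ℝ) with hD
  have hDd : Dense (Set.range D) := TopologicalSpace.denseRange_denseSeq _
  let V : ℕ → Set C(AddCircle (1 : ℝ), ℝ) := fun n =>
    {q | (D n).2 ∈ Set.Ioo (0 : ℝ) 1 → ArnoldLocked ω β q (D n)}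
  have hV : ∀ n, IsOpen (V n) ∧ Dense (V n) := by
    intro n
    by_cases h : (D n).2 ∈ Set.Ioo (0 : ℝ) 1
    · have : V n = {q | ArnoldLocked ω β q (D n)} := by
        ext q; exact ⟨fun hq => hq h, fun hq _ => hq⟩
      rw [this]
      exact ⟨isOpen_setOf_arnoldLocked_forcing hω β _, dense_setOf_arnoldLocked_forcing hω hβ h⟩
    · have : V n = Set.univ := Set.eq_univ_of_forall fun q hq => (h hq).elim
      rw [this]
      exact ⟨isOpen_univ, dense_univ⟩
  refine ⟨⋂ n, V n, ⟨V, hV, subset_rfl⟩, fun q hq => ⟨isOpen_arnoldLocked hω β q, fun p hp => ?_⟩⟩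
  have hopen : IsOpen (Set.univ ×ˢ Set.Ioo (0 : ℝ) 1 : Set (ℝ × ℝ)) := isOpen_univ.prod isOpen_Ioo
  refine closure_mono ?_ (hDd.open_subset_closure_inter hopen hp)
  rintro _ ⟨hx, n, rfl⟩
  exact Set.mem_iInter.mp hq n hx.2

end

end ForcedCircle
end

section
/- Let (H, d_H, ι_H) be the data of Example I or Example II. The set of contractable H ∈ C⁰(X,H) is open and dense in C⁰(X,H) with respect to the metric D_H. -/
open Filter Topology MeasureTheory

namespace ForcedCircle

theorem liftDist_self (r : ℕ) (f : ℝ → ℝ) : liftDist r f f = 0 := by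
  simp [liftDist, crDist]

theorem liftDistInf_self (f : ℝ → ℝ) : liftDistInf f f = 0 := by
  simp [liftDistInf, liftDist_self]

theorem HData.IsExampleI.dist_self {hd : HData} (hI : hd.IsExampleI) (h : hd.H) :
    hd.dist h h = 0 := by
  obtain ⟨r, -, e, -, hfin, hinf⟩ := hI
  induction r using ENat.recTopCoe with
  | top => rw [hinf rfl, liftDistInf_self]
  | coe n => rw [hfin n rfl, liftDist_self]

/-- The lift of the forced circle map `(x, w) ↦ (g x, w + P w + θ x)`. -/
def shiftLift {X : Type*} (P : ℝ → ℝ) (θ : X → ℝ) : X → ℝ → ℝ := fun x y => y + P y + θ x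

theorem continuous_fiberIter_shiftLift {X : Type*} [TopologicalSpace X] [CompactSpace X]
    [R1Space X] {g : X → X} (hg : Continuous g) {P : ℝ → ℝ} (hP : Continuous P) (n : ℕ) :
    Continuous fun p : C(X, ℝ) × X × ℝ => fiberIter g (shiftLift P p.1) n p.2.1 p.2.2 := by
  induction n with
  | zero => exact continuous_snd.snd
  | succ n ih =>
    have hgn : Continuous fun p : C(X, ℝ) × X × ℝ => p.1 (g^[n] p.2.1) :=
      continuous_eval.comp (continuous_fst.prodMk ((hg.iterate n).comp continuous_snd.fst))
    exact (ih.add (hP.comp ih)).add hgn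

theorem fiberIter_shiftLift_add_one {X : Type*} (g : X → X) {P : ℝ → ℝ}
    (hP : Function.Periodic P 1) (θ : X → ℝ) (n : ℕ) (x : X) (w : ℝ) :
    fiberIter g (shiftLift P θ) n x (w + 1) = fiberIter g (shiftLift P θ) n x w + 1 := by
  induction n with
  | zero => rfl
  | succ n ih =>
    simp only [fiberIter, shiftLift] at ih ⊢
    rw [ih, hP]
    ring

theorem periodic_deriv {f : ℝ → ℝ} {c : ℝ} (hf : Function.Periodic f c) :
    Function.Periodic (deriv f) c := fun y => by
  rw [← deriv_comp_add_const, funext hf]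

/-- By periodicity it suffices to test the contractability condition for `w ∈ [0, 1]`. -/
theorem contractableWith_of_Icc {X : Type*} {g : X → X} {P : ℝ → ℝ} {θ : X → ℝ}
    (hP : Function.Periodic P 1) {k : ℕ} (hk : 1 < k)
    (h : ∀ x, ∀ w ∈ Set.Icc (0 : ℝ) 1, ∃ i ≤ k - 2,
      deriv (deriv P) (fiberIter g (shiftLift P θ) (i + 1) x w) ≠ 0) :
    ContractableWith g P (shiftLift P θ) := by
  refine ⟨k, hk, fun x w => ?_⟩
  obtain ⟨i, hi, hne⟩ := h x (Int.fract w) ⟨Int.fract_nonneg w, (Int.fract_lt_one w).le⟩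
  refine ⟨i, hi, ?_⟩
  have hper : Function.Periodic
      (fun w => deriv (deriv P) (fiberIter g (shiftLift P θ) (i + 1) x w)) 1 := fun w => by
    simp only [fiberIter_shiftLift_add_one g hP, periodic_deriv (periodic_deriv hP) _]
  have := hper.sub_zsmul_eq (x := w) ⌊w⌋
  rw [zsmul_one, Int.self_sub_floor] at this
  rwa [← this]

theorem ContractableWith.eventually {X : Type*} [TopologicalSpace X] [CompactSpace X] [R1Space X]
    {g : X → X} (hg : Continuous g) {P : ℝ → ℝ} (hP : Continuous P)
    (hper : Function.Periodic P 1) (hP2 : Continuous (deriv (deriv P))) {θ : C(X, ℝ)}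
    (h : ContractableWith g P (shiftLift P θ)) :
    ∀ᶠ θ' : C(X, ℝ) in 𝓝 θ, ContractableWith g P (shiftLift P θ') := by
  obtain ⟨k, hk, hne⟩ := h
  have hK : IsCompact ((Set.univ : Set X) ×ˢ Set.Icc (0 : ℝ) 1) := isCompact_univ.prod isCompact_Icc
  have hev := hK.eventually_forall_of_forall_eventually (x₀ := θ)
    (P := fun θ' q => ∃ i ≤ k - 2,
      deriv (deriv P) (fiberIter g (shiftLift P θ') (i + 1) q.1 q.2) ≠ 0) fun q _ => by
    obtain ⟨i, hi, hne⟩ := hne q.1 q.2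
    have hc := hP2.comp (continuous_fiberIter_shiftLift hg hP (i + 1))
    filter_upwards [hc.continuousAt.eventually_ne (x := (θ, q)) hne] with z hz
    exact ⟨i, hi, hz⟩
  filter_upwards [hev] with θ' hθ'
  exact contractableWith_of_Icc hper hk fun x w hw => hθ' (x, w) ⟨Set.mem_univ x, hw⟩

theorem GoodP.continuous {P : ℝ → ℝ} (hP : GoodP P) : Continuous P :=
  continuousOn_univ.1 hP.1.continuousOn

theorem GoodP.analyticOnNhd_deriv_deriv {P : ℝ → ℝ} (hP : GoodP P) :
    AnalyticOnNhd ℝ (deriv (deriv P)) Set.univ := hP.1.deriv.deriv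

theorem GoodP.exists_deriv_deriv_ne_zero {P : ℝ → ℝ} (hP : GoodP P) :
    ∃ y, deriv (deriv P) y ≠ 0 := by
  by_contra! h0
  obtain ⟨a, b, hab⟩ := hP.2.2.1
  have hd : Differentiable ℝ P := fun y => (hP.1 y trivial).differentiableAt
  have hd' : Differentiable ℝ (deriv P) := fun y => (hP.1.deriv y trivial).differentiableAt
  obtain ⟨c, -, hc⟩ := exists_deriv_eq_zero (f := P) zero_lt_one hP.continuous.continuousOn
    (by simpa using (hP.2.1 0).symm)
  exact hab (is_const_of_deriv_eq_zero hd
    (fun y => (is_const_of_deriv_eq_zero hd' h0 y c).trans hc) a b)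

theorem GoodP.countable_deriv_deriv_eq_zero {P : ℝ → ℝ} (hP : GoodP P) :
    {y | deriv (deriv P) y = 0}.Countable := by
  obtain ⟨y, hy⟩ := hP.exists_deriv_deriv_ne_zero
  have h := hP.analyticOnNhd_deriv_deriv.preimage_zero_mem_codiscrete hy
  have hdisc := (mem_codiscrete'.1 h).2
  rw [← Set.preimage_compl, compl_compl] at hdisc
  have : DiscreteTopology {y | deriv (deriv P) y = 0} := hdisc.to_subtype
  exact Set.countable_coe_iff.1 (TopologicalSpace.separableSpace_iff_countable.1 inferInstance)

/-- In a compact space, the forward orbits of a minimal map hit a nonempty open set at a positive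
time bounded independently of the starting point. -/
theorem Minimal.exists_bounded_hitting {X : Type*} [TopologicalSpace X] [CompactSpace X]
    {g : X → X} (hmin : Minimal g) (hg : Continuous g) {V : Set X} (hV : IsOpen V)
    (hne : V.Nonempty) : ∃ N, ∀ x, ∃ n < N, g^[n + 1] x ∈ V := by
  obtain ⟨t, ht⟩ := isCompact_univ.elim_finite_subcover (fun n : ℕ => g^[n + 1] ⁻¹' V)
    (fun n => hV.preimage (hg.iterate _)) fun x _ => by
      obtain ⟨_, ⟨n, rfl⟩, hn⟩ := (hmin (g x)).exists_mem_open hV hne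
      exact Set.mem_iUnion.2 ⟨n, hn⟩
  refine ⟨t.sup id + 1, fun x => ?_⟩
  obtain ⟨n, hn, hx⟩ := Set.mem_iUnion₂.1 (ht (Set.mem_univ x))
  exact ⟨n, Nat.lt_succ_of_le (Finset.le_sup (f := id) hn), hx⟩

/-- If the value of `θ` at a single point is not of the form `z' - (z + P z)` with `z, z'` zeros
of `P''`, then the contractability condition holds. -/
theorem contractableWith_of_value {X : Type*} [TopologicalSpace X] [CompactSpace X]
    {g : X → X} (hmin : Minimal g) (hg : Continuous g) {P : ℝ → ℝ} (hP : Continuous P)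
    (hper : Function.Periodic P 1) (hP2 : Continuous (deriv (deriv P)))
    {θ : X → ℝ} (hθ : Continuous θ) (x₀ : X)
    (hx₀ : ∀ z z', deriv (deriv P) z = 0 → deriv (deriv P) z' = 0 → θ x₀ ≠ z' - (z + P z)) :
    ContractableWith g P (shiftLift P θ) := by
  set Q := deriv (deriv P)
  have hev := (isCompact_Icc (a := (0 : ℝ)) (b := 1)).eventually_forall_of_forall_eventually
    (x₀ := x₀) (P := fun x w => Q w ≠ 0 ∨ Q (shiftLift P θ x w) ≠ 0) fun w _ => by
    by_cases hw : Q w = 0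
    · have hw' : Q (shiftLift P θ x₀ w) ≠ 0 := fun h =>
        hx₀ w _ hw h (by simp [shiftLift])
      have hc : Continuous fun p : X × ℝ => Q (shiftLift P θ p.1 p.2) := by
        unfold shiftLift
        fun_prop
      exact (hc.continuousAt.eventually_ne (x := (x₀, w)) hw').mono fun _ => Or.inr
    · have hc : Continuous fun p : X × ℝ => Q p.2 := by fun_prop
      exact (hc.continuousAt.eventually_ne (x := (x₀, w)) hw).mono fun _ => Or.inl
  obtain ⟨V, hVsub, hVo, hxV⟩ := mem_nhds_iff.1 hev
  have hQper : Function.Periodic Q 1 := periodic_deriv (periodic_deriv hper)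
  have hV : ∀ x ∈ V, ∀ w, Q w ≠ 0 ∨ Q (shiftLift P θ x w) ≠ 0 := fun x hx w => by
    have hper' : Function.Periodic (fun w => Q (shiftLift P θ x w)) 1 := fun w => by
      have := fiberIter_shiftLift_add_one id hper θ 1 x w
      simp only [fiberIter, Function.iterate_zero, id] at this
      simp only [this, hQper _]
    have h := hVsub hx (Int.fract w) ⟨Int.fract_nonneg w, (Int.fract_lt_one w).le⟩
    have h1 := hQper.sub_zsmul_eq (x := w) ⌊w⌋
    have h2 := hper'.sub_zsmul_eq (x := w) ⌊w⌋
    rw [zsmul_one, Int.self_sub_floor] at h1 h2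
    rwa [h1, h2] at h
  obtain ⟨N, hN⟩ := hmin.exists_bounded_hitting hg hVo ⟨x₀, hxV⟩
  refine ⟨N + 2, by omega, fun x w => ?_⟩
  obtain ⟨n, hn, hnV⟩ := hN x
  rcases hV _ hnV (fiberIter g (shiftLift P θ) (n + 1) x w) with h | h
  · exact ⟨n, by omega, h⟩
  · exact ⟨n + 1, by omega, h⟩

theorem GoodP.exists_contractableWith {X : Type*} [TopologicalSpace X] [CompactSpace X]
    [Nonempty X] {g : X → X} (hmin : Minimal g) (hg : Continuous g) {P : ℝ → ℝ} (hP : GoodP P)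
    {θ : X → ℝ} (hθ : Continuous θ) {ε : ℝ} (hε : 0 < ε) :
    ∃ c ∈ Set.Ioo 0 ε, ContractableWith g P (shiftLift P fun x => θ x + c) := by
  obtain ⟨x₀⟩ := ‹Nonempty X›
  have hZ := hP.countable_deriv_deriv_eq_zero
  have hB := hZ.image2 hZ fun z z' => z' - (z + P z) - θ x₀
  obtain ⟨c, hc, hcε⟩ := (hB.dense_compl ℝ).exists_mem_open isOpen_Ioo (Set.nonempty_Ioo.2 hε)
  refine ⟨c, hcε, contractableWith_of_value hmin hg hP.continuous hP.2.1
    (continuousOn_univ.1 hP.analyticOnNhd_deriv_deriv.continuousOn) (hθ.add_const c) x₀ ?_⟩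
  exact fun z z' hz hz' heq => hc ⟨z, hz, z', hz', by linarith⟩

theorem HData.IsExampleIIIWith.phi_eq {X : Type*} {hd : HData} {P : ℝ → ℝ} {e : hd.H ≃ ℝ}
    (h : hd.IsExampleIIIWith P e) (H : X → hd.H) :
    Phi hd H = shiftLift P fun x => e (H x) :=
  funext fun x => funext fun y => h.2.2 (H x) y

theorem HData.IsExampleIIIWith.contH_iff {X : Type*} [TopologicalSpace X] {hd : HData}
    {P : ℝ → ℝ} {e : hd.H ≃ ℝ} (h : hd.IsExampleIIIWith P e) {H : X → hd.H} :
    ContH hd H ↔ Continuous fun x => e (H x) := by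
  simp only [ContH, h.2.1, continuous_iff_continuousAt, Metric.continuousAt_iff',
    Filter.eventually_iff_exists_mem, Real.dist_eq, abs_sub_comm]

theorem HData.IsExampleIIIWith.dist_le_DH {X : Type*} [TopologicalSpace X] [CompactSpace X]
    {hd : HData} {P : ℝ → ℝ} {e : hd.H ≃ ℝ} (h : hd.IsExampleIIIWith P e) {H H' : X → hd.H}
    (hH : ContH hd H) (hH' : ContH hd H') (x : X) : |e (H x) - e (H' x)| ≤ DH hd H H' := by
  rw [h.contH_iff] at hH hH'
  have hb := (isCompact_range (hH.sub hH').abs).bddAbove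
  simp only [DH, h.2.1]
  exact le_ciSup hb x

/-- the set of contractable `H ∈ C⁰(X,ℋ)` is open and dense in
`(C⁰(X,ℋ), D_ℋ)`. -/
theorem contractable_open_dense
    {X : Type} [MetricSpace X] [CompactSpace X] [MeasurableSpace X] [BorelSpace X]
    (g : X ≃ₜ X) (hue : UniquelyErgodic (⇑g)) (hmin : Minimal (⇑g))
    (hfac : HasFinDimNonperiodicFactor (⇑g))
    (hd : HData) (hex : hd.IsExampleI ∨ hd.IsExampleII) :
    OpenInC0 hd {H : X → hd.H | Contractable hd (⇑g) H} ∧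
      DenseInC0 hd {H : X → hd.H | Contractable hd (⇑g) H} := by
  have : Nonempty X := by
    obtain ⟨d, Y, gbar, h, hY, -, -, hsurj, -⟩ := hfac
    obtain ⟨y, hy⟩ := hY.nonempty
    exact ⟨(hsurj ⟨y, hy⟩).choose⟩
  constructor
  · rintro H hH (hI | ⟨P, e, hII, hC⟩)
    · exact ⟨1, one_pos, fun H' _ _ => Or.inl hI⟩
    · have hP := hII.1.1
      rw [hII.1.phi_eq] at hC
      have hev := ContractableWith.eventually (θ := ⟨_, hII.1.contH_iff.1 hH⟩) g.continuous
        hP.continuous hP.2.1 (continuousOn_univ.1 hP.analyticOnNhd_deriv_deriv.continuousOn) hC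
      obtain ⟨ε, hε, hball⟩ := Metric.eventually_nhds_iff.1 hev
      refine ⟨ε, hε, fun H' hH' hlt => Or.inr ⟨P, e, hII, ?_⟩⟩
      rw [hII.1.phi_eq]
      refine hball (y := ⟨_, hII.1.contH_iff.1 hH'⟩) ((ContinuousMap.dist_lt_iff hε).2 fun x => ?_)
      rw [dist_comm]
      exact (hII.1.dist_le_DH hH hH' x).trans_lt hlt
  · intro H hH ε hε
    rcases hex with hI | ⟨P, e, hII⟩
    · exact ⟨H, hH, by simpa [DH, hI.dist_self] using hε, Or.inl hI⟩
    · have hθ := hII.1.contH_iff.1 hH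
      obtain ⟨c, ⟨hc0, hcε⟩, hC⟩ := hII.1.1.exists_contractableWith hmin g.continuous hθ hε
      refine ⟨fun x => e.symm (e (H x) + c), ?_, ?_, Or.inr ⟨P, e, hII, ?_⟩⟩
      · simpa [hII.1.contH_iff] using hθ.add_const c
      · simpa [DH, hII.1.2.1, abs_of_pos hc0] using hcε
      · simpa [hII.1.phi_eq] using hC


end ForcedCircle
end
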